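/- Let d be a positive integer and let J ⊊ I be squarefree monomial ideals of S such that I is minimally generated by four squarefree monomials f_1, f_2, f_3, f_4 of degree d, and J is either 0 or generated by squarefree monomials of degrees ≥ d+1. Suppose there exists c ∈ C such that supp c is not contained in supp f_1 ∪ supp f_2 ∪ supp f_3 ∪ supp f_4. If sdepth_S I/J = d+1, then depth_S I/J ≤ d+1. -/

import Mathlib

open MvPolynomial

/-- The squarefree monomial `∏_{i ∈ T} x_i` in `K[x_1,…,x_n]`. -/
noncomputable def sqm (K : Type*) [Field K] {n : ℕ} (T : Finset (Fin n)) :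
    MvPolynomial (Fin n) K := ∏ i ∈ T, X i

/-- The poset `P_{I \ J}` of (supports of) squarefree monomials of `I \ J`. -/
def sqPoset {K : Type*} [Field K] {n : ℕ} (I J : Ideal (MvPolynomial (Fin n) K)) :
    Set (Finset (Fin n)) :=
  {T | sqm K T ∈ I ∧ sqm K T ∉ J}

/-- The squarefree monomials of degree `k` in `I \ J`. -/
def degSet {K : Type*} [Field K] {n : ℕ} (I J : Ideal (MvPolynomial (Fin n) K)) (k : ℕ) :
    Set (Finset (Fin n)) :=
  {T ∈ sqPoset I J | T.card = k}

/-- A partition of `P_{I\J}` into intervals `[u,v]`, recorded as a finite set of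
pairs `(u, v)`: each monomial of `P_{I\J}` lies in exactly one interval. -/
def IsIntervalPartition {K : Type*} [Field K] {n : ℕ}
    (I J : Ideal (MvPolynomial (Fin n) K))
    (F : Finset (Finset (Fin n) × Finset (Fin n))) : Prop :=
  (∀ p ∈ F, p.1 ∈ sqPoset I J ∧ p.2 ∈ sqPoset I J ∧ p.1 ⊆ p.2) ∧
  (∀ T ∈ sqPoset I J, ∃! p, p ∈ F ∧ p.1 ⊆ T ∧ T ⊆ p.2)

/-- The Stanley depth of `I/J`: the maximum over interval partitions of the
minimal degree of an upper endpoint. -/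
noncomputable def sdepth {K : Type*} [Field K] {n : ℕ}
    (I J : Ideal (MvPolynomial (Fin n) K)) : ℕ :=
  sSup {k | ∃ F, IsIntervalPartition I J F ∧ ∀ p ∈ F, k ≤ p.2.card}

/-- The depth of a module over `K[x_1,…,x_n]` with respect to the maximal ideal
`(x_1,…,x_n)`: the supremum of lengths of regular sequences from `(x_1,…,x_n)`. -/
noncomputable def mdepth {K : Type*} [Field K] {n : ℕ}
    (M : Type*) [AddCommGroup M] [Module (MvPolynomial (Fin n) K) M] : ℕ :=
  sSup {k | ∃ rs : List (MvPolynomial (Fin n) K), rs.length = k ∧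
    (∀ r ∈ rs, r ∈ Ideal.span (Set.range X : Set (MvPolynomial (Fin n) K))) ∧
    RingTheory.Sequence.IsRegular M rs}

/-- The `S`-module `I/J` (more precisely `I/(J ∩ I)`). -/
abbrev quotMod {K : Type*} [Field K] {n : ℕ} (I J : Ideal (MvPolynomial (Fin n) K)) :=
  I ⧸ (Submodule.comap I.subtype J)

/-- `depth_S I/J`. -/
noncomputable def depthIJ {K : Type*} [Field K] {n : ℕ}
    (I J : Ideal (MvPolynomial (Fin n) K)) : ℕ :=
  mdepth (K := K) (n := n) (quotMod I J)

/-- An ideal is a squarefree monomial ideal generated in degrees `≥ d` if it is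
the span of squarefree monomials whose supports have at least `d` elements. -/
def SqfreeGenFrom {K : Type*} [Field K] {n : ℕ}
    (L : Ideal (MvPolynomial (Fin n) K)) (d : ℕ) : Prop :=
  ∃ G : Set (Finset (Fin n)), (∀ T ∈ G, d ≤ T.card) ∧ L = Ideal.span (sqm K '' G)

/-- A squarefree monomial ideal. -/
def IsSqfreeMonomialIdeal {K : Type*} [Field K] {n : ℕ}
    (L : Ideal (MvPolynomial (Fin n) K)) : Prop :=
  ∃ G : Set (Finset (Fin n)), L = Ideal.span (sqm K '' G)

/-- The sign `(-1)^#{i ∈ T | i < k}` attached to the position of `k` in `T`. -/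
def posSign (R : Type*) [Ring R] {n : ℕ} (k : Fin n) (T : Finset (Fin n)) : R :=
  (-1) ^ (T.filter (· < k)).card

/-- The Koszul differential with respect to `x` on cochains `Finset (Fin n) → M`. -/
def koszulD {R M : Type*} [CommRing R] [AddCommGroup M] [Module R M] {n : ℕ} (x : Fin n → R) :
    (Finset (Fin n) → M) →ₗ[R] (Finset (Fin n) → M) :=
  LinearMap.pi fun T => ∑ k ∈ T, (posSign R k T * x k) • LinearMap.proj (T.erase k)

section Koszul

variable {R M : Type*} [CommRing R] [AddCommGroup M] [Module R M] {n : ℕ}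

theorem koszulD_apply (x : Fin n → R) (ω : Finset (Fin n) → M) (T : Finset (Fin n)) :
    koszulD x ω T = ∑ k ∈ T, (posSign R k T * x k) • ω (T.erase k) := by
  simp [koszulD]

theorem posSign_mul_self (k : Fin n) (T : Finset (Fin n)) :
    posSign R k T * posSign R k T = 1 := by
  simp [posSign, ← pow_add, ← two_mul]

theorem posSign_erase_self (k : Fin n) (T : Finset (Fin n)) :
    posSign R k (T.erase k) = posSign R k T := by
  unfold posSign
  congr 2
  ext i
  simp only [Finset.mem_filter, Finset.mem_erase]
  constructor
  · exact fun h => ⟨h.1.2, h.2⟩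
  · exact fun h => ⟨⟨h.2.ne, h.1⟩, h.2⟩

theorem posSign_erase_of_lt {k l : Fin n} {T : Finset (Fin n)} (hl : l ∈ T) (h : l < k) :
    posSign R k (T.erase l) = - posSign R k T := by
  unfold posSign
  have : T.filter (· < k) = insert l ((T.erase l).filter (· < k)) := by
    ext i
    simp only [Finset.mem_filter, Finset.mem_erase, Finset.mem_insert]
    constructor
    · rintro ⟨h1, h2⟩
      by_cases hi : i = l
      · exact Or.inl hi
      · exact Or.inr ⟨⟨hi, h1⟩, h2⟩
    · rintro (rfl | h1)
      · exact ⟨hl, h⟩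
      · exact ⟨h1.1.2, h1.2⟩
  rw [this, Finset.card_insert_of_notMem (by simp), pow_succ]
  ring

theorem posSign_erase_of_gt {k l : Fin n} {T : Finset (Fin n)} (h : k < l) :
    posSign R k (T.erase l) = posSign R k T := by
  unfold posSign
  congr 2
  ext i
  simp only [Finset.mem_filter, Finset.mem_erase]
  constructor
  · exact fun h => ⟨h.1.2, h.2⟩
  · exact fun h' => ⟨⟨(h'.2.trans h).ne, h'.1⟩, h'.2⟩

theorem posSign_mul_posSign_erase {k l : Fin n} {T : Finset (Fin n)} (hk : k ∈ T) (hl : l ∈ T)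
    (h : k ≠ l) :
    posSign R k T * posSign R l (T.erase k) = -(posSign R l T * posSign R k (T.erase l)) := by
  rcases lt_or_gt_of_ne h with h | h
  · rw [posSign_erase_of_lt hk h, posSign_erase_of_gt h]; ring
  · rw [posSign_erase_of_lt hl h, posSign_erase_of_gt h]; ring

theorem koszulD_koszulD (x : Fin n → R) (ω : Finset (Fin n) → M) :
    koszulD x (koszulD x ω) = 0 := by
  funext T
  simp only [koszulD_apply, Finset.smul_sum, smul_smul, Pi.zero_apply]
  rw [Finset.sum_sigma']
  refine Finset.sum_involution (fun p _ => ⟨p.2, p.1⟩) ?_ ?_ ?_ ?_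
  · rintro ⟨k, l⟩ hp
    simp only [Finset.mem_sigma, Finset.mem_erase] at hp
    obtain ⟨hk, hlk, hl⟩ := hp
    simp only
    rw [Finset.erase_right_comm, ← add_smul]
    convert zero_smul R _ using 2
    linear_combination (x k * x l) * posSign_mul_posSign_erase (R := R) hk hl hlk.symm
  · rintro ⟨k, l⟩ hp _ heq
    simp only [Finset.mem_sigma, Finset.mem_erase] at hp
    simp only [Sigma.mk.injEq, heq_eq_eq] at heq
    exact hp.2.1 heq.1
  · rintro ⟨k, l⟩ hp
    simp only [Finset.mem_sigma, Finset.mem_erase] at hp ⊢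
    exact ⟨hp.2.2, hp.2.1.symm, hp.1⟩
  · rintro ⟨k, l⟩ _
    rfl

/-- Contraction of a cochain by the `j`-th basis vector. -/
def koszulContract (j : Fin n) (ω : Finset (Fin n) → M) : Finset (Fin n) → M :=
  fun T => if j ∈ T then 0 else posSign R j T • ω (insert j T)

theorem koszulD_koszulContract (x : Fin n → R) (j : Fin n) {ω : Finset (Fin n) → M}
    (hω : koszulD x ω = 0) (T : Finset (Fin n)) :
    koszulD x (koszulContract (R := R) j ω) T = x j • ω T := by
  rw [koszulD_apply]
  by_cases hj : j ∈ T
  · rw [Finset.sum_eq_single j]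
    · simp only [koszulContract, Finset.notMem_erase, if_false, Finset.insert_erase hj, smul_smul,
        posSign_erase_self]
      congr 1
      linear_combination x j * posSign_mul_self (R := R) j T
    · intro k _ hk
      have : j ∈ T.erase k := Finset.mem_erase.2 ⟨hk.symm, hj⟩
      simp [koszulContract, this]
    · exact fun h => absurd hj h
  · have h0 := congrFun hω (insert j T)
    rw [koszulD_apply, Finset.sum_insert hj, Finset.erase_insert hj, Pi.zero_apply] at h0
    have h1 := congrArg (posSign R j T • ·) h0
    simp only [smul_add, smul_zero, Finset.smul_sum, smul_smul] at h1
    have h2 : posSign R j (insert j T) = posSign R j T := by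
      rw [← posSign_erase_self (R := R) j (insert j T), Finset.erase_insert hj]
    rw [h2, ← mul_assoc, posSign_mul_self, one_mul] at h1
    rw [eq_neg_of_add_eq_zero_left h1, ← Finset.sum_neg_distrib]
    refine Finset.sum_congr rfl fun k hk => ?_
    have hkj : k ≠ j := fun h => hj (h ▸ hk)
    have h3 : j ∉ T.erase k := fun h => hj (Finset.mem_of_mem_erase h)
    simp only [koszulContract, h3, if_false, smul_smul]
    rw [Finset.erase_insert_of_ne hkj.symm, ← neg_smul]
    congr 1
    have h4 := posSign_mul_posSign_erase (R := R) (k := k) (l := j) (T := insert j T)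
      (Finset.mem_insert_of_mem hk) (Finset.mem_insert_self _ _) hkj
    have h5 : posSign R j ((insert j T).erase k) = posSign R j (T.erase k) := by
      rw [← posSign_erase_self (R := R) j ((insert j T).erase k), Finset.erase_right_comm,
        Finset.erase_insert hj]
    rw [h5, h2, Finset.erase_insert hj] at h4
    have h6 := posSign_mul_self (R := R) j T
    have h7 := posSign_mul_self (R := R) j (T.erase k)
    linear_combination (posSign R j T * posSign R j (T.erase k) * x k) * h4 -
      (x k * posSign R j T * posSign R k (insert j T)) * h7 -
      (x k * posSign R k T * posSign R j (T.erase k)) * h6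

theorem exists_koszulD_eq_of_isWeaklyRegular (x : Fin n → R) (rs : List R)
    (hrs : ∀ r ∈ rs, r ∈ Ideal.span (Set.range x))
    (hreg : RingTheory.Sequence.IsWeaklyRegular M rs) (ω : Finset (Fin n) → M)
    (hsupp : ∀ T, rs.length ≤ T.card → ω T = 0) (hω : koszulD x ω = 0) :
    ∃ η : Finset (Fin n) → M, ω = koszulD x η := by
  induction rs generalizing M with
  | nil => exact ⟨0, by rw [map_zero]; exact funext fun T => hsupp T (Nat.zero_le _)⟩
  | cons r rs ih =>
    rw [RingTheory.Sequence.isWeaklyRegular_cons_iff] at hreg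
    obtain ⟨a, ha⟩ := (Ideal.mem_span_range_iff_exists_fun).1 (hrs r (by simp))
    set w : Finset (Fin n) → M := ∑ j, a j • koszulContract (R := R) j ω with hw
    have hdw : koszulD x w = r • ω := by
      funext T
      simp only [hw, map_sum, map_smul, Finset.sum_apply, Pi.smul_apply,
        koszulD_koszulContract x _ hω, smul_smul]
      rw [← Finset.sum_smul, ha]
    let π : M →ₗ[R] QuotSMulTop r M := Submodule.mkQ _
    have hπ : ∀ ζ : Finset (Fin n) → M, koszulD x (fun T => π (ζ T)) =
        fun T => π (koszulD x ζ T) := by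
      intro ζ
      funext T
      simp [koszulD_apply]
    have hr0 : ∀ m : M, π (r • m) = 0 := fun m =>
      (Submodule.Quotient.mk_eq_zero _).2 (Submodule.smul_mem_pointwise_smul _ _ _ trivial)
    obtain ⟨η, hη⟩ := ih (M := QuotSMulTop r M) (fun s hs => hrs s (by simp [hs])) hreg.2
      (fun T => π (w T)) (by
        intro T hT
        have : w T = 0 := by
          rw [hw, Finset.sum_apply]
          refine Finset.sum_eq_zero fun j _ => ?_
          simp only [Pi.smul_apply, koszulContract]
          split_ifs with hj
          · simp
          · rw [hsupp _ (by rw [Finset.card_insert_of_notMem hj]; simpa using hT)]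
            simp
        simp [this]) (by
        rw [hπ, hdw]
        funext T
        exact hr0 _)
    have hsurj : ∀ T, ∃ m, π m = η T := fun T => Submodule.mkQ_surjective _ _
    choose η' hη' using hsurj
    have h1 : ∀ T, ∃ u : M, w T - koszulD x η' T = r • u := by
      intro T
      have h2 : π (w T - koszulD x η' T) = 0 := by
        rw [map_sub, sub_eq_zero]
        have : π (w T) = koszulD x η T := congrFun hη T
        rw [this, ← congrFun (hπ η') T]
        simp only [hη']
      have h3 := (Submodule.Quotient.mk_eq_zero _).1 h2
      obtain ⟨u, _, hu⟩ := h3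
      exact ⟨u, hu.symm⟩
    choose u hu using h1
    refine ⟨u, funext fun T => hreg.1 ?_⟩
    have h4 : w - koszulD x η' = r • u := funext hu
    have h5 := congrArg (koszulD x) h4
    rw [map_sub, koszulD_koszulD, sub_zero, hdw, map_smul] at h5
    exact congrFun h5 T

end Koszul

/-- The coboundary on `K`-valued cochains on the subsets of `Fin n`. -/
abbrev coboundary (K : Type*) [Field K] (n : ℕ) :
    (Finset (Fin n) → K) →ₗ[K] (Finset (Fin n) → K) :=
  koszulD fun _ => 1

theorem coboundary_apply {K : Type*} [Field K] {n : ℕ} (φ : Finset (Fin n) → K)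
    (T : Finset (Fin n)) :
    coboundary K n φ T = ∑ k ∈ T, posSign K k T * φ (T.erase k) := by
  simp [koszulD_apply]

section MonomialIdeals

variable {K : Type*} [Field K] {n : ℕ}

theorem sqm_eq_monomial (T : Finset (Fin n)) :
    sqm K T = monomial (∑ i ∈ T, Finsupp.single i 1) 1 := by
  rw [monomial_sum_one]
  rfl

theorem sum_single_apply (T : Finset (Fin n)) (i : Fin n) :
    (∑ j ∈ T, Finsupp.single j 1 : Fin n →₀ ℕ) i = if i ∈ T then 1 else 0 := by
  rw [Finsupp.finsetSum_apply]
  simp [Finsupp.single_apply]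

theorem sum_single_le_iff {S T : Finset (Fin n)} :
    (∑ j ∈ S, Finsupp.single j 1 : Fin n →₀ ℕ) ≤ ∑ j ∈ T, Finsupp.single j 1 ↔ S ⊆ T := by
  constructor
  · intro h i hi
    have := h i
    rw [sum_single_apply, sum_single_apply, if_pos hi] at this
    by_contra hT
    simp [hT] at this
  · intro h i
    rw [sum_single_apply, sum_single_apply]
    by_cases hi : i ∈ S
    · simp [hi, h hi]
    · simp [hi]

/-- The coefficient of the squarefree monomial with support `T`. -/
noncomputable def sqCoeff (T : Finset (Fin n)) : MvPolynomial (Fin n) K →ₗ[K] K :=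
  lcoeff K (∑ i ∈ T, Finsupp.single i 1)

theorem sqCoeff_eq_zero {G : Set (Finset (Fin n))} {p : MvPolynomial (Fin n) K}
    (hp : p ∈ Ideal.span (sqm K '' G)) {T : Finset (Fin n)} (hT : ∀ g ∈ G, ¬ g ⊆ T) :
    sqCoeff T p = 0 := by
  have himg : sqm K '' G = (fun s => monomial s (1 : K)) ''
      ((fun g : Finset (Fin n) => ∑ i ∈ g, Finsupp.single i 1) '' G) := by
    rw [Set.image_image]
    exact Set.image_congr fun g _ => sqm_eq_monomial g
  rw [himg, mem_ideal_span_monomial_image] at hp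
  by_contra h
  obtain ⟨_, ⟨g, hg, rfl⟩, hle⟩ := hp _ (mem_support_iff.2 h)
  exact hT g hg (sum_single_le_iff.1 hle)

theorem sqCoeff_sqm_self (T : Finset (Fin n)) : sqCoeff T (sqm K T) = 1 := by
  simp [sqCoeff, sqm_eq_monomial]

theorem sqm_mem_span_iff {G : Set (Finset (Fin n))} {T : Finset (Fin n)} :
    sqm K T ∈ Ideal.span (sqm K '' G) ↔ ∃ g ∈ G, g ⊆ T := by
  constructor
  · intro h
    by_contra! hG
    exact one_ne_zero ((sqCoeff_sqm_self (K := K) T).symm.trans (sqCoeff_eq_zero h hG))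
  · rintro ⟨g, hg, hgT⟩
    rw [sqm, ← Finset.prod_sdiff hgT]
    exact Ideal.mul_mem_left _ _ (Ideal.subset_span ⟨g, hg, rfl⟩)

theorem sqCoeff_X_mul (k : Fin n) (T : Finset (Fin n)) (p : MvPolynomial (Fin n) K) :
    sqCoeff T (X k * p) = if k ∈ T then sqCoeff (T.erase k) p else 0 := by
  simp only [sqCoeff, lcoeff_apply]
  rw [coeff_X_mul']
  have : k ∈ (∑ i ∈ T, Finsupp.single i 1 : Fin n →₀ ℕ).support ↔ k ∈ T := by
    rw [Finsupp.mem_support_iff, sum_single_apply]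
    simp
  simp only [this]
  split_ifs with hk
  · rw [← Finset.add_sum_erase _ _ hk, add_tsub_cancel_left]
  · rfl

theorem X_mul_sqm_erase {k : Fin n} {T : Finset (Fin n)} (hk : k ∈ T) :
    (X k : MvPolynomial (Fin n) K) * sqm K (T.erase k) = sqm K T :=
  Finset.mul_prod_erase T _ hk

theorem posSign_eq_C (k : Fin n) (T : Finset (Fin n)) :
    posSign (MvPolynomial (Fin n) K) k T = C (posSign K k T) := by
  simp [posSign]

theorem sqCoeff_C_mul (a : K) (T : Finset (Fin n)) (p : MvPolynomial (Fin n) K) :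
    sqCoeff T (C a * p) = a * sqCoeff T p := by
  rw [← smul_eq_C_mul, map_smul, smul_eq_mul]

theorem sqCoeff_koszulD (S T : Finset (Fin n))
    (p : Finset (Fin n) → MvPolynomial (Fin n) K) :
    sqCoeff S (koszulD (X : Fin n → MvPolynomial (Fin n) K) p T) =
      ∑ k ∈ T, posSign K k T * if k ∈ S then sqCoeff (S.erase k) (p (T.erase k)) else 0 := by
  rw [koszulD_apply, map_sum]
  refine Finset.sum_congr rfl fun k _ => ?_
  rw [smul_eq_mul, posSign_eq_C, mul_assoc, sqCoeff_C_mul, sqCoeff_X_mul]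

/-- A cochain of polynomials in `I` that is a cocycle modulo `J` and vanishes in degrees at least
the length of a regular sequence on `I / J` is a coboundary modulo `J`. -/
theorem exists_cochain_of_isWeaklyRegular {I J : Ideal (MvPolynomial (Fin n) K)}
    {rs : List (MvPolynomial (Fin n) K)}
    (hrs : ∀ r ∈ rs, r ∈ Ideal.span (Set.range X : Set (MvPolynomial (Fin n) K)))
    (hreg : RingTheory.Sequence.IsWeaklyRegular (quotMod I J) rs)
    (q : Finset (Fin n) → MvPolynomial (Fin n) K) (hqI : ∀ T, q T ∈ I)
    (hsupp : ∀ T, rs.length ≤ T.card → q T = 0)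
    (hq : ∀ T, koszulD (X : Fin n → MvPolynomial (Fin n) K) q T ∈ J) :
    ∃ p : Finset (Fin n) → MvPolynomial (Fin n) K,
      (∀ T, p T ∈ I) ∧ ∀ T, q T - koszulD (X : Fin n → MvPolynomial (Fin n) K) p T ∈ J := by
  let π : I →ₗ[MvPolynomial (Fin n) K] quotMod I J := Submodule.mkQ _
  have hπ : ∀ u : I, π u = 0 ↔ (u : MvPolynomial (Fin n) K) ∈ J := fun u =>
    (Submodule.Quotient.mk_eq_zero _)
  have hkI : ∀ p : Finset (Fin n) → I, ∀ T,
      ((koszulD (M := I) (X : Fin n → MvPolynomial (Fin n) K) p T : I) : MvPolynomial (Fin n) K) =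
        koszulD (X : Fin n → MvPolynomial (Fin n) K)
          (fun S => (p S : MvPolynomial (Fin n) K)) T := by
    intro p T
    simp [koszulD_apply]
  have hkπ : ∀ p : Finset (Fin n) → I,
      koszulD (X : Fin n → MvPolynomial (Fin n) K) (fun S => π (p S)) =
        fun T => π (koszulD (M := I) (X : Fin n → MvPolynomial (Fin n) K) p T) := by
    intro p
    funext T
    simp [koszulD_apply]
  obtain ⟨η, hη⟩ := exists_koszulD_eq_of_isWeaklyRegular X rs hrs hreg
    (fun T => π ⟨q T, hqI T⟩)
    (fun T hT => (hπ _).2 (by simp [hsupp T hT]))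
    (by
      rw [hkπ]
      funext T
      refine (hπ _).2 ?_
      rw [hkI]
      exact hq T)
  have hsurj : ∀ T, ∃ u, π u = η T := fun T => Submodule.mkQ_surjective _ _
  choose p hp using hsurj
  refine ⟨fun T => p T, fun T => (p T).2, fun T => ?_⟩
  have h1 : π (⟨q T, hqI T⟩ -
      koszulD (M := I) (X : Fin n → MvPolynomial (Fin n) K) p T) = 0 := by
    have h2 : π ⟨q T, hqI T⟩ = koszulD (X : Fin n → MvPolynomial (Fin n) K) η T := congrFun hη T
    rw [map_sub, sub_eq_zero, h2, ← congrFun (hkπ p) T]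
    simp only [hp]
  have h3 := (hπ _).1 h1
  simpa [hkI] using h3

/-- The acyclicity properties of the degree `d`, `d + 1`, `d + 2` pieces `E`, `B`, `C` of a
poset of squarefree monomials that are forced by depth at least `d + 2`. -/
structure IsAcyclicTriple (K : Type*) [Field K] {n : ℕ} (d : ℕ)
    (E B C : Finset (Finset (Fin n))) : Prop where
  lt : d < n
  card_E : ∀ e ∈ E, e.card = d
  card_B : ∀ b ∈ B, b.card = d + 1
  card_C : ∀ c ∈ C, c.card = d + 2
  mem_B : ∀ c ∈ C, ∀ e ∈ E, ∀ b : Finset (Fin n), b.card = d + 1 → e ⊆ b → b ⊆ c → b ∈ B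
  exact : ∀ ψ : Finset (Fin n) → K, (∀ T ∉ B, ψ T = 0) → (∀ c ∈ C, coboundary K n ψ c = 0) →
    ∃ φ : Finset (Fin n) → K, (∀ T ∉ E, φ T = 0) ∧ ∀ b ∈ B, ψ b = coboundary K n φ b
  avoid : ∀ (j : Fin n) (φ : Finset (Fin n) → K), (∀ T ∉ E, φ T = 0) →
    (∀ b ∈ B, j ∉ b → coboundary K n φ b = 0) → ∀ e ∈ E, j ∉ e → φ e = 0

open Classical in
theorem isAcyclicTriple_of_isWeaklyRegular {d : ℕ} {G H : Set (Finset (Fin n))} (hdn : d < n)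
    (hG : ∀ g ∈ G, g.card = d) (hH : ∀ g ∈ H, d + 1 ≤ g.card)
    {rs : List (MvPolynomial (Fin n) K)} (hlen : d + 2 ≤ rs.length)
    (hrs : ∀ r ∈ rs, r ∈ Ideal.span (Set.range X : Set (MvPolynomial (Fin n) K)))
    (hreg : RingTheory.Sequence.IsWeaklyRegular
      (quotMod (Ideal.span (sqm K '' G)) (Ideal.span (sqm K '' H))) rs) :
    IsAcyclicTriple K d (Finset.univ.filter (· ∈ G))
      (Finset.univ.filter fun T => T.card = d + 1 ∧ (∃ g ∈ G, g ⊆ T) ∧ ∀ g ∈ H, ¬ g ⊆ T)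
      (Finset.univ.filter fun T => T.card = d + 2 ∧ (∃ g ∈ G, g ⊆ T) ∧ ∀ g ∈ H, ¬ g ⊆ T) where
  lt := hdn
  card_E := by simpa using hG
  card_B := by simp +contextual
  card_C := by simp +contextual
  mem_B := by
    simp only [Finset.mem_filter, Finset.mem_univ, true_and]
    exact fun c hc e he b hb heb hbc =>
      ⟨hb, ⟨e, he, heb⟩, fun g hg hgb => hc.2.2 g hg (hgb.trans hbc)⟩
  exact := by
    simp only [Finset.mem_filter, Finset.mem_univ, true_and]
    intro ψ hψ hcoc
    have key : ∀ T, koszulD (X : Fin n → MvPolynomial (Fin n) K) (fun S => C (ψ S) * sqm K S) T =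
        C (coboundary K n ψ T) * sqm K T := by
      intro T
      rw [koszulD_apply, coboundary_apply, map_sum, Finset.sum_mul]
      refine Finset.sum_congr rfl fun k hk => ?_
      rw [← X_mul_sqm_erase hk, posSign_eq_C, smul_eq_mul, C_mul]
      ring
    obtain ⟨p, hpI, hp⟩ := exists_cochain_of_isWeaklyRegular hrs hreg
      (fun S => C (ψ S) * sqm K S)
      (by
        intro T
        by_cases hT : ∃ g ∈ G, g ⊆ T
        · exact Ideal.mul_mem_left _ _ (sqm_mem_span_iff.2 hT)
        · rw [hψ T fun h => hT h.2.1]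
          simp)
      (by
        intro T hT
        rw [hψ T fun h => by omega]
        simp)
      (by
        intro T
        rw [key]
        by_cases hT : coboundary K n ψ T = 0
        · simp [hT]
        refine Ideal.mul_mem_left _ _ (sqm_mem_span_iff.2 ?_)
        by_contra! hJ
        refine hT (hcoc T ⟨?_, ?_, hJ⟩) <;>
        · rw [coboundary_apply] at hT
          obtain ⟨k, hk, hne⟩ := Finset.exists_ne_zero_of_sum_ne_zero hT
          have hB := not_imp_comm.1 (hψ (T.erase k)) (right_ne_zero_of_mul hne)
          first
          | have := hB.1
            rw [Finset.card_erase_of_mem hk] at this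
            omega
          | obtain ⟨g, hg, hgT⟩ := hB.2.1
            exact ⟨g, hg, hgT.trans (Finset.erase_subset _ _)⟩)
    refine ⟨fun T => if T ∈ G then sqCoeff T (p T) else 0, fun T hT => if_neg hT, ?_⟩
    intro b hb
    have h1 := sqCoeff_eq_zero (hp b) hb.2.2
    rw [map_sub, sub_eq_zero, sqCoeff_C_mul, sqCoeff_sqm_self, mul_one, sqCoeff_koszulD] at h1
    rw [h1, coboundary_apply]
    refine Finset.sum_congr rfl fun k hk => ?_
    rw [if_pos hk]
    split_ifs with hG'
    · rfl
    · rw [sqCoeff_eq_zero (hpI _) fun g hg hgb => hG' ?_]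
      rwa [← Finset.eq_of_subset_of_card_le hgb]
      rw [Finset.card_erase_of_mem hk, hb.1, hG g hg]
      simp
  avoid := by
    simp only [Finset.mem_filter, Finset.mem_univ, true_and]
    intro j φ hφ hcoc e he hje
    have key : ∀ T, koszulD (X : Fin n → MvPolynomial (Fin n) K) (fun S => if j ∈ S then
        C (posSign K j S * φ (S.erase j)) * sqm K (S.erase j) else 0) T =
        if j ∈ T then - C (posSign K j T * coboundary K n φ (T.erase j)) * sqm K (T.erase j)
          else 0 := by
      intro T
      rw [koszulD_apply]
      split_ifs with hj
      · rw [← Finset.add_sum_erase _ _ hj, if_neg (by simp), smul_zero, zero_add,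
          coboundary_apply, Finset.mul_sum, map_sum, ← Finset.sum_neg_distrib, Finset.sum_mul]
        refine Finset.sum_congr rfl fun k hk => ?_
        have hk' := Finset.mem_erase.1 hk
        rw [if_pos (Finset.mem_erase.2 ⟨hk'.1.symm, hj⟩), posSign_eq_C, Finset.erase_right_comm,
          ← X_mul_sqm_erase hk, smul_eq_mul, ← mul_assoc (posSign K j T),
          ← neg_eq_iff_eq_neg.2 (posSign_mul_posSign_erase (R := K) hk'.2 hj hk'.1)]
        simp only [C_mul, C_neg]
        ring
      · refine Finset.sum_eq_zero fun k _ => ?_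
        rw [if_neg fun h => hj (Finset.mem_of_mem_erase h), smul_zero]
    obtain ⟨p, hpI, hp⟩ := exists_cochain_of_isWeaklyRegular hrs hreg
      (fun S => if j ∈ S then C (posSign K j S * φ (S.erase j)) * sqm K (S.erase j) else 0)
      (by
        intro T
        split_ifs
        · by_cases hT : T.erase j ∈ G
          · exact Ideal.mul_mem_left _ _ (sqm_mem_span_iff.2 ⟨_, hT, subset_rfl⟩)
          · simp [hφ _ hT]
        · exact zero_mem _)
      (by
        intro T hT
        split_ifs with hj
        · rw [hφ]
          · simp
          · intro h
            have := hG _ h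
            rw [Finset.card_erase_of_mem hj] at this
            omega
        · rfl)
      (by
        intro T
        rw [key]
        split_ifs with hj
        · by_cases hT : coboundary K n φ (T.erase j) = 0
          · simp [hT]
          refine Ideal.mul_mem_left _ _ (sqm_mem_span_iff.2 ?_)
          by_contra! hJ
          refine hT (hcoc _ ⟨?_, ?_, hJ⟩ (by simp)) <;>
          · rw [coboundary_apply] at hT
            obtain ⟨k, hk, hne⟩ := Finset.exists_ne_zero_of_sum_ne_zero hT
            have hB := not_imp_comm.1 (hφ ((T.erase j).erase k)) (right_ne_zero_of_mul hne)
            first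
            | have := hG _ hB
              have h1 := Finset.card_pos.2 ⟨k, hk⟩
              rw [Finset.card_erase_of_mem hk] at this
              omega
            | exact ⟨_, hB, Finset.erase_subset _ _⟩
        · exact zero_mem _)
    have h1 := sqCoeff_eq_zero (hp (insert j e)) (T := e) fun g hg hge => by
      have := Finset.card_le_card hge
      have := hH g hg
      have := hG e he
      omega
    rw [map_sub, sub_eq_zero, if_pos (Finset.mem_insert_self _ _), sqCoeff_C_mul,
      Finset.erase_insert hje, sqCoeff_sqm_self, mul_one, sqCoeff_koszulD] at h1
    rw [Finset.sum_eq_zero] at h1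
    · have h2 := congrArg (posSign K j (insert j e) * ·) h1
      simpa only [← mul_assoc, posSign_mul_self, one_mul, mul_zero] using h2
    · intro k hk
      split_ifs with hke
      · rw [sqCoeff_eq_zero (hpI _), mul_zero]
        intro g hg hge
        have h3 := Finset.card_le_card hge
        rw [Finset.card_erase_of_mem hke, hG g hg, hG e he] at h3
        have := Finset.card_pos.2 ⟨k, hke⟩
        have := hG e he
        omega
      · rw [mul_zero]

end MonomialIdeals

theorem exists_disjoint_injective {K F ι : Type*} [Field K] [AddCommGroup F] [Module K F]
    [DecidableEq ι] (r : ι → F →ₗ[K] K) (C : Finset ι) :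
    ∀ X₁ X₂ : Submodule K F,
      (∀ x ∈ X₁, ∀ y ∈ X₂, (∀ c ∈ C, r c (x + y) = 0) → x = 0 ∧ y = 0) →
      ∃ C₁ ⊆ C, ∃ C₂ ⊆ C, Disjoint C₁ C₂ ∧ (∀ x ∈ X₁, (∀ c ∈ C₁, r c x = 0) → x = 0) ∧
        ∀ y ∈ X₂, (∀ c ∈ C₂, r c y = 0) → y = 0 := by
  induction C using Finset.induction_on with
  | empty =>
    intro X₁ X₂ h
    refine ⟨∅, subset_rfl, ∅, subset_rfl, by simp, fun x hx _ => ?_, fun y hy _ => ?_⟩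
    · exact (h x hx 0 (zero_mem _) (by simp)).1
    · exact (h 0 (zero_mem _) y hy (by simp)).2
  | insert c C hc ih =>
    intro X₁ X₂ h
    by_cases h₁ : ∀ x ∈ X₁ ⊓ LinearMap.ker (r c), ∀ y ∈ X₂,
        (∀ c ∈ C, r c (x + y) = 0) → x = 0 ∧ y = 0
    · obtain ⟨C₁, hC₁, C₂, hC₂, hdis, hi₁, hi₂⟩ := ih _ _ h₁
      refine ⟨insert c C₁, Finset.insert_subset_insert _ hC₁, C₂,
        hC₂.trans (Finset.subset_insert _ _), ?_, fun x hx hx' => ?_, hi₂⟩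
      · rw [Finset.disjoint_insert_left]
        exact ⟨fun h => hc (hC₂ h), hdis⟩
      · exact hi₁ x ⟨hx, hx' c (Finset.mem_insert_self _ _)⟩
          fun c' hc' => hx' c' (Finset.mem_insert_of_mem hc')
    by_cases h₂ : ∀ x ∈ X₁, ∀ y ∈ X₂ ⊓ LinearMap.ker (r c),
        (∀ c ∈ C, r c (x + y) = 0) → x = 0 ∧ y = 0
    · obtain ⟨C₁, hC₁, C₂, hC₂, hdis, hi₁, hi₂⟩ := ih _ _ h₂
      refine ⟨C₁, hC₁.trans (Finset.subset_insert _ _), insert c C₂,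
        Finset.insert_subset_insert _ hC₂, ?_, hi₁, fun y hy hy' => ?_⟩
      · rw [Finset.disjoint_insert_right]
        exact ⟨fun h => hc (hC₁ h), hdis⟩
      · exact hi₂ y ⟨hy, hy' c (Finset.mem_insert_self _ _)⟩
          fun c' hc' => hy' c' (Finset.mem_insert_of_mem hc')
    exfalso
    push Not at h₁ h₂
    obtain ⟨x, ⟨hx, hxc⟩, y, hy, hxy, hne⟩ := h₁
    obtain ⟨x', hx', y', ⟨hy', hyc⟩, hxy', hne'⟩ := h₂
    have hxc : r c x = 0 := hxc
    have hyc : r c y' = 0 := hyc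
    have ha : r c y ≠ 0 := by
      intro ha
      obtain ⟨h1, h2⟩ := h x hx y hy (by
        intro c' hc'
        rcases Finset.mem_insert.1 hc' with rfl | hc'
        · rw [map_add, hxc, ha, add_zero]
        · exact hxy c' hc')
      exact hne h1 h2
    have ha' : r c x' ≠ 0 := by
      intro ha
      obtain ⟨h1, h2⟩ := h x' hx' y' hy' (by
        intro c' hc'
        rcases Finset.mem_insert.1 hc' with rfl | hc'
        · rw [map_add, hyc, ha, add_zero]
        · exact hxy' c' hc')
      exact hne' h1 h2
    obtain ⟨h1, -⟩ := h (r c x' • x - r c y • x')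
      (sub_mem (Submodule.smul_mem _ _ hx) (Submodule.smul_mem _ _ hx'))
      (r c x' • y - r c y • y')
      (sub_mem (Submodule.smul_mem _ _ hy) (Submodule.smul_mem _ _ hy')) (by
        intro c' hc'
        rcases Finset.mem_insert.1 hc' with rfl | hc'
        · simp only [map_add, map_sub, map_smul, hxc, hyc, smul_eq_mul]
          ring
        · have h1 := hxy c' hc'
          have h2 := hxy' c' hc'
          simp only [map_add, map_sub, map_smul, smul_eq_mul] at h1 h2 ⊢
          linear_combination r c x' * h1 - r c y * h2)
    have h2 := congrArg (r c) h1
    simp only [map_sub, map_smul, hxc, smul_eq_mul, mul_zero, zero_sub, map_zero, neg_eq_zero,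
      mul_eq_zero] at h2
    exact h2.elim ha ha'

section Cochains

variable {K : Type*} [Field K] {n : ℕ}

/-- The cochains vanishing outside `X`. -/
def cochainsOn (K : Type*) [Field K] {n : ℕ} (X : Finset (Finset (Fin n))) :
    Submodule K (Finset (Fin n) → K) where
  carrier := {ψ | ∀ T ∉ X, ψ T = 0}
  add_mem' h h' T hT := by simp [h T hT, h' T hT]
  zero_mem' _ _ := rfl
  smul_mem' a _ h T hT := by simp [h T hT]

theorem cochainsOn_mono {X Y : Finset (Finset (Fin n))} (h : X ⊆ Y) :
    cochainsOn K X ≤ cochainsOn K Y :=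
  fun _ hψ T hT => hψ T fun hX => hT (h hX)

/-- The restriction of a cochain to `X`, extended by zero. -/
def restrictTo (X : Finset (Finset (Fin n))) :
    (Finset (Fin n) → K) →ₗ[K] (Finset (Fin n) → K) where
  toFun ψ T := if T ∈ X then ψ T else 0
  map_add' ψ ψ' := by
    funext T
    simp only [Pi.add_apply]
    split_ifs <;> simp
  map_smul' a ψ := by
    funext T
    simp

theorem restrictTo_apply_of_mem {X : Finset (Finset (Fin n))} (ψ : Finset (Fin n) → K)
    {T : Finset (Fin n)} (hT : T ∈ X) : restrictTo X ψ T = ψ T :=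
  if_pos hT

theorem restrictTo_mem (X : Finset (Finset (Fin n))) (ψ : Finset (Fin n) → K) :
    restrictTo X ψ ∈ cochainsOn K X :=
  fun _ hT => if_neg hT

theorem coboundary_eq_zero {φ : Finset (Fin n) → K} {T : Finset (Fin n)}
    (h : ∀ k ∈ T, φ (T.erase k) = 0) : coboundary K n φ T = 0 := by
  rw [coboundary_apply]
  exact Finset.sum_eq_zero fun k hk => by rw [h k hk, mul_zero]

theorem coboundary_eq_zero_of_mem {X : Finset (Finset (Fin n))} {φ : Finset (Fin n) → K}
    (hφ : φ ∈ cochainsOn K X) {T : Finset (Fin n)} (h : ∀ e ∈ X, ¬ e ⊆ T) :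
    coboundary K n φ T = 0 :=
  coboundary_eq_zero fun _ _ => hφ _ fun hX => h _ hX (Finset.erase_subset _ _)

theorem coboundary_coboundary (φ : Finset (Fin n) → K) (T : Finset (Fin n)) :
    coboundary K n (coboundary K n φ) T = 0 :=
  congrFun (koszulD_koszulD _ _) T

theorem coboundary_restrictTo {X : Finset (Finset (Fin n))} {φ : Finset (Fin n) → K}
    {c : Finset (Fin n)}
    (h : ∀ k ∈ c, c.erase k ∉ X → φ (c.erase k) = 0) :
    coboundary K n (restrictTo X φ) c = coboundary K n φ c := by
  rw [coboundary_apply, coboundary_apply]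
  refine Finset.sum_congr rfl fun k hk => ?_
  by_cases hX : c.erase k ∈ X
  · rw [restrictTo_apply_of_mem _ hX]
  · rw [restrictTo_mem X φ _ hX, h k hk hX]

/-- A cochain on `X` is determined by the values of its coboundary on `D`. -/
def CoboundaryInjOn (K : Type*) [Field K] {n : ℕ} (X D : Finset (Finset (Fin n))) : Prop :=
  ∀ ψ ∈ cochainsOn K X, (∀ c ∈ D, coboundary K n ψ c = 0) → ψ = 0

theorem CoboundaryInjOn.exists_injOn {X D : Finset (Finset (Fin n))}
    (h : CoboundaryInjOn K X D) :
    ∃ m : Finset (Fin n) → Finset (Fin n), (∀ x ∈ X, m x ∈ D ∧ x ⊆ m x) ∧ Set.InjOn m X := by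
  induction X using Finset.induction_on generalizing D with
  | empty => exact ⟨id, by simp, by simp⟩
  | insert x X hx ih =>
    obtain ⟨D₁, hD₁, D₂, hD₂, hdis, hi₁, hi₂⟩ := exists_disjoint_injective
      (fun c => LinearMap.proj c ∘ₗ coboundary K n) D (cochainsOn K {x}) (cochainsOn K X) (by
        intro ψ hψ ψ' hψ' h'
        have h0 := h (ψ + ψ') (add_mem (cochainsOn_mono (by simp) hψ)
          (cochainsOn_mono (by simp) hψ')) h'
        have h1 : ψ' = 0 := by
          funext T
          by_cases hT : T ∈ X
          · have h2 := congrFun h0 T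
            rw [Pi.add_apply, hψ T (by rw [Finset.mem_singleton]; rintro rfl; exact hx hT),
              zero_add] at h2
            exact h2
          · exact hψ' T hT
        rw [h1, add_zero] at h0
        exact ⟨h0, h1⟩)
    obtain ⟨m, hm, hinj⟩ := ih (D := D₂) hi₂
    have h1 : ∃ c ∈ D₁, x ⊆ c := by
      by_contra! hc
      have h2 := hi₁ (Pi.single x 1)
        (fun T hT => Pi.single_eq_of_ne (by simpa using hT) _)
        (fun c hc' => coboundary_eq_zero fun _ _ => Pi.single_eq_of_ne (by
          rintro rfl
          exact hc c hc' (Finset.erase_subset _ _)) _)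
      have h3 := congrFun h2 x
      simp at h3
    obtain ⟨c, hc, hxc⟩ := h1
    refine ⟨Function.update m x c, fun y hy => ?_, ?_⟩
    · by_cases hyx : y = x
      · subst hyx
        simpa using ⟨hD₁ hc, hxc⟩
      · have := hm y (Finset.mem_of_mem_insert_of_ne hy hyx)
        simpa [hyx] using ⟨hD₂ this.1, this.2⟩
    · have hne : ∀ y ∈ X, m y ≠ c := fun y hy h =>
        Finset.disjoint_left.1 hdis hc (h ▸ (hm y hy).1)
      intro y hy z hz hyz
      simp only [Finset.coe_insert, Set.mem_insert_iff, Finset.mem_coe] at hy hz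
      rcases hy with rfl | hy <;> rcases hz with rfl | hz
      · rfl
      · have : z ≠ y := fun h => hx (h ▸ hz)
        simp only [Function.update_self, Function.update_of_ne this] at hyz
        exact absurd hyz.symm (hne z hz)
      · have : y ≠ z := fun h => hx (h ▸ hy)
        simp only [Function.update_self, Function.update_of_ne this] at hyz
        exact absurd hyz (hne y hy)
      · have h1 : y ≠ x := fun h => hx (h ▸ hy)
        have h2 : z ≠ x := fun h => hx (h ▸ hz)
        simp only [Function.update_of_ne h1, Function.update_of_ne h2] at hyz
        exact hinj hy hz hyz

variable {d : ℕ} {E B C : Finset (Finset (Fin n))}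

/-- The set `C` splits into a part detecting the cochains on `B₁` and a part making the upward
closed piece `(E₂, B₂)` acyclic. -/
theorem IsAcyclicTriple.exists_split (h : IsAcyclicTriple K d E B C)
    {E₂ B₁ B₂ : Finset (Finset (Fin n))} (hE : E₂ ⊆ E) (hB₁ : B₁ ⊆ B) (hB₂ : B₂ ⊆ B)
    (hdis : Disjoint B₁ B₂) (hup : ∀ e ∈ E₂, ∀ b ∈ B, e ⊆ b → b ∈ B₂)
    (hZ : ∀ φ ∈ cochainsOn K E, (∀ b ∈ B, b ∉ B₁ → b ∉ B₂ → coboundary K n φ b = 0) →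
      φ ∈ cochainsOn K E₂) :
    ∃ C₁ ⊆ C, ∃ C₂ ⊆ C, Disjoint C₁ C₂ ∧ CoboundaryInjOn K B₁ C₁ ∧
      IsAcyclicTriple K d E₂ B₂ C₂ := by
  have hzero : ∀ φ ∈ cochainsOn K E₂, ∀ b ∈ B, b ∉ B₂ → coboundary K n φ b = 0 :=
    fun φ hφ b hb hb' => coboundary_eq_zero_of_mem hφ fun e he heb => hb' (hup e he b hb heb)
  have hcoc : ∀ φ ∈ cochainsOn K E₂, ∀ c ∈ C,
      coboundary K n (restrictTo B₂ (coboundary K n φ)) c = 0 := by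
    intro φ hφ c hc
    rw [coboundary_restrictTo, coboundary_coboundary]
    intro k hk hkB
    refine coboundary_eq_zero_of_mem hφ fun e he hec => hkB (hup e he _ ?_ hec)
    refine h.mem_B c hc e (hE he) _ ?_ hec (Finset.erase_subset _ _)
    rw [Finset.card_erase_of_mem hk, h.card_C c hc]
    rfl
  obtain ⟨Q, hQ⟩ := Submodule.exists_isCompl
    ((cochainsOn K E₂).map (restrictTo B₂ ∘ₗ coboundary K n))
  obtain ⟨C₁, hC₁, C₂, hC₂, hCdis, hi₁, hi₂⟩ := exists_disjoint_injective
    (fun c => LinearMap.proj c ∘ₗ coboundary K n) C (cochainsOn K B₁) (cochainsOn K B₂ ⊓ Q) (by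
      rintro x hx y ⟨hy, hyQ⟩ hxy
      obtain ⟨φ, hφ, hφB⟩ := h.exact (x + y)
        (add_mem (cochainsOn_mono hB₁ hx) (cochainsOn_mono hB₂ hy)) hxy
      have hφ₂ : φ ∈ cochainsOn K E₂ := hZ φ hφ fun b hb hb₁ hb₂ => by
        rw [← hφB b hb, Pi.add_apply, hx b hb₁, hy b hb₂, add_zero]
      have hx0 : x = 0 := by
        funext b
        by_cases hb : b ∈ B₁
        · have hb₂ := Finset.disjoint_left.1 hdis hb
          have h1 := hφB b (hB₁ hb)
          rwa [Pi.add_apply, hy b hb₂, add_zero, hzero φ hφ₂ b (hB₁ hb) hb₂] at h1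
        · exact hx b hb
      refine ⟨hx0, Submodule.disjoint_def.1 hQ.disjoint y ?_ hyQ⟩
      refine ⟨φ, hφ₂, ?_⟩
      funext b
      by_cases hb : b ∈ B₂
      · rw [LinearMap.comp_apply, restrictTo_apply_of_mem _ hb, ← hφB b (hB₂ hb), hx0, zero_add]
      · rw [LinearMap.comp_apply, restrictTo_mem _ _ _ hb, hy b hb])
  refine ⟨C₁, hC₁, C₂, hC₂, hCdis, hi₁, ?_⟩
  refine ⟨h.lt, fun e he => h.card_E e (hE he), fun b hb => h.card_B b (hB₂ hb),
    fun c hc => h.card_C c (hC₂ hc), fun c hc e he b hb heb hbc =>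
      hup e he b (h.mem_B c (hC₂ hc) e (hE he) b hb heb hbc) heb, ?_, ?_⟩
  · intro ψ hψ hψC
    obtain ⟨_, ⟨φ, hφ, rfl⟩, z, hz, hsum⟩ :=
      Submodule.mem_sup.1 (hQ.sup_eq_top ▸ Submodule.mem_top :
        ψ ∈ (cochainsOn K E₂).map (restrictTo B₂ ∘ₗ coboundary K n) ⊔ Q)
    have hz' : z = ψ - restrictTo B₂ (coboundary K n φ) := by
      rw [← hsum]
      simp
    have hz0 : z = 0 := by
      refine hi₂ z ⟨?_, hz⟩ fun c hc => ?_
      · rw [hz']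
        exact sub_mem hψ (restrictTo_mem _ _)
      · rw [hz']
        simp [hψC c hc, hcoc φ hφ c (hC₂ hc)]
    refine ⟨φ, hφ, fun b hb => ?_⟩
    rw [← hsum, hz0, add_zero, LinearMap.comp_apply, restrictTo_apply_of_mem _ hb]
  · intro j φ hφ hφB e he hje
    refine h.avoid j φ (cochainsOn_mono hE hφ) (fun b hb hjb => ?_) e (hE he) hje
    by_cases hb₂ : b ∈ B₂
    · exact hφB b hb₂ hjb
    · exact hzero φ hφ b hb hb₂

/-- Removing from `C` an element above no element of `B`. -/
theorem IsAcyclicTriple.erase (h : IsAcyclicTriple K d E B C) {c₀ : Finset (Fin n)}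
    (hc₀ : ∀ b ∈ B, ¬ b ⊆ c₀) : IsAcyclicTriple K d E B (C.erase c₀) where
  lt := h.lt
  card_E := h.card_E
  card_B := h.card_B
  card_C c hc := h.card_C c (Finset.mem_of_mem_erase hc)
  mem_B c hc := h.mem_B c (Finset.mem_of_mem_erase hc)
  exact ψ hψ hψC := by
    refine h.exact ψ hψ fun c hc => ?_
    by_cases hcc : c = c₀
    · rw [hcc]
      exact coboundary_eq_zero_of_mem hψ hc₀
    · exact hψC c (Finset.mem_erase.2 ⟨hcc, hc⟩)
  avoid := h.avoid

end Cochains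

theorem eq_or_eq_of_card_eq {α : Type*} [DecidableEq α] {d : ℕ} {a b b' u x : Finset α}
    (ha : a.card = d) (hb : b.card = d + 1) (hb' : b'.card = d + 1) (hx : x.card = d + 1)
    (hu : u.card = d + 2) (hab : a ⊆ b) (hab' : a ⊆ b') (hax : a ⊆ x) (hbu : b ⊆ u)
    (hbu' : b' ⊆ u) (hxu : x ⊆ u) (hne : b ≠ b') : x = b ∨ x = b' := by
  have hs : ∀ y : Finset α, y.card = d + 1 → a ⊆ y → ∃ i, y \ a = {i} := fun y hy hay => by
    rw [← Finset.card_eq_one, Finset.card_sdiff_of_subset hay, hy, ha]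
    omega
  have hrec : ∀ y : Finset α, a ⊆ y → y = a ∪ y \ a := fun y hay => by
    rw [Finset.union_sdiff_of_subset hay]
  obtain ⟨i, hi⟩ := hs b hb hab
  obtain ⟨i', hi'⟩ := hs b' hb' hab'
  obtain ⟨k, hk⟩ := hs x hx hax
  have hii : i ≠ i' := by
    rintro rfl
    exact hne (by rw [hrec b hab, hrec b' hab', hi, hi'])
  have h2 : (u \ a).card = 2 := by
    rw [Finset.card_sdiff_of_subset (hab.trans hbu), hu, ha]
    omega
  have h3 : u \ a = {i, i'} := by
    symm
    apply Finset.eq_of_subset_of_card_le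
    · rw [Finset.insert_subset_iff, Finset.singleton_subset_iff]
      constructor
      · exact Finset.sdiff_subset_sdiff hbu subset_rfl (by rw [hi]; simp)
      · exact Finset.sdiff_subset_sdiff hbu' subset_rfl (by rw [hi']; simp)
    · rw [h2, Finset.card_pair hii]
  have h4 : k ∈ ({i, i'} : Finset α) := by
    rw [← h3]
    exact Finset.sdiff_subset_sdiff hxu subset_rfl (by rw [hk]; simp)
  rcases Finset.mem_insert.1 h4 with h | h
  · left
    rw [hrec x hax, hk, h, ← hi, ← hrec b hab]
  · right
    rw [hrec x hax, hk, Finset.mem_singleton.1 h, ← hi', ← hrec b' hab']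

/-- Two distinct `d`-subsets lie in at most one `(d + 1)`-subset. -/
theorem eq_of_subset_of_subset {α : Type*} [DecidableEq α] {d : ℕ} {e e' b b' : Finset α}
    (he : e.card = d) (he' : e'.card = d) (hne : e ≠ e') (hb : b.card = d + 1)
    (hb' : b'.card = d + 1) (h₁ : e ⊆ b) (h₂ : e' ⊆ b) (h₁' : e ⊆ b') (h₂' : e' ⊆ b') :
    b = b' := by
  have h : d < (e ∪ e').card := by
    rw [← he]
    refine Finset.card_lt_card ⟨Finset.subset_union_left, fun h => hne ?_⟩
    exact (Finset.eq_of_subset_of_card_le (Finset.subset_union_right.trans h) (by omega)).symm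
  rw [← Finset.eq_of_subset_of_card_le (Finset.union_subset h₁ h₂) (by omega),
    ← Finset.eq_of_subset_of_card_le (Finset.union_subset h₁' h₂') (by omega)]

section Contradiction

variable {K : Type*} [Field K] {n : ℕ} {d : ℕ} {E B C : Finset (Finset (Fin n))}

theorem single_mem_cochainsOn {e : Finset (Fin n)} (he : e ∈ E) (a : K) :
    Pi.single e a ∈ cochainsOn K E :=
  fun _ hT => Pi.single_eq_of_ne (by rintro rfl; exact hT he) _

theorem coboundary_single_eq_zero {e b : Finset (Fin n)} (a : K) (h : ¬ e ⊆ b) :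
    coboundary K n (Pi.single e a) b = 0 :=
  coboundary_eq_zero_of_mem (X := {e}) (single_mem_cochainsOn (by simp) a) (by simpa)

theorem exists_erase_eq {e b : Finset (Fin n)} (h : e ⊆ b) (hcard : b.card = e.card + 1) :
    ∃ k ∈ b, b.erase k = e := by
  obtain ⟨k, hk⟩ : ∃ k, b \ e = {k} := by
    rw [← Finset.card_eq_one, Finset.card_sdiff_of_subset h]
    omega
  have hkb : k ∈ b \ e := by simp [hk]
  rw [Finset.mem_sdiff] at hkb
  refine ⟨k, hkb.1, ?_⟩
  symm
  refine Finset.eq_of_subset_of_card_le (fun i hi => Finset.mem_erase.2 ⟨?_, h hi⟩) ?_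
  · rintro rfl
    exact hkb.2 hi
  · rw [Finset.card_erase_of_mem hkb.1]
    omega

theorem coboundary_eq_mul {φ : Finset (Fin n) → K} {b : Finset (Fin n)} {k : Fin n} (hk : k ∈ b)
    (h : ∀ l ∈ b, l ≠ k → φ (b.erase l) = 0) :
    coboundary K n φ b = posSign K k b * φ (b.erase k) := by
  rw [coboundary_apply]
  refine Finset.sum_eq_single_of_mem k hk fun l hl hlk => ?_
  rw [h l hl hlk, mul_zero]

theorem posSign_ne_zero (k : Fin n) (b : Finset (Fin n)) : posSign K k b ≠ 0 :=
  left_ne_zero_of_mul_eq_one (posSign_mul_self k b)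

theorem eq_zero_of_coboundary_eq_zero {φ : Finset (Fin n) → K} {e b : Finset (Fin n)} (h : e ⊆ b)
    (hcard : b.card = e.card + 1) (hb : coboundary K n φ b = 0)
    (hφ : ∀ e' ⊆ b, b.card = e'.card + 1 → e' ≠ e → φ e' = 0) : φ e = 0 := by
  obtain ⟨k, hk, rfl⟩ := exists_erase_eq h hcard
  rw [coboundary_eq_mul hk] at hb
  · exact (mul_eq_zero.1 hb).resolve_left (posSign_ne_zero _ _)
  · intro l hl hlk
    refine hφ _ (Finset.erase_subset _ _) ?_ ?_
    · rw [Finset.card_erase_add_one hl]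
    · intro h'
      have : l ∈ b.erase k := Finset.mem_erase.2 ⟨hlk, hl⟩
      rw [← h'] at this
      simp at this

theorem coboundary_single_ne_zero {e b : Finset (Fin n)} (h : e ⊆ b)
    (hcard : b.card = e.card + 1) : coboundary K n (Pi.single e 1) b ≠ 0 := by
  intro h0
  have h1 := eq_zero_of_coboundary_eq_zero (φ := Pi.single e (1 : K)) h hcard h0
    fun e' _ _ hne => Pi.single_eq_of_ne hne _
  simp at h1

/-- If `y` divides no generator and `δφ` vanishes on the links of `y` in `C`, then `δφ` vanishes
on the elements of `B` containing `y`. -/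
theorem IsAcyclicTriple.coboundary_eq_zero_of_link (h : IsAcyclicTriple K d E B C) {y : Fin n}
    (hy : ∀ e ∈ E, y ∉ e) {φ : Finset (Fin n) → K} (hφ : φ ∈ cochainsOn K E)
    (hlink : ∀ c ∈ C, y ∈ c → coboundary K n φ (c.erase y) = 0) {b : Finset (Fin n)}
    (hb : b ∈ B) (hyb : y ∈ b) : coboundary K n φ b = 0 := by
  have hX : ∀ T, T ∈ B.filter (y ∈ ·) ↔ T ∈ B ∧ y ∈ T := fun T => Finset.mem_filter
  obtain ⟨φ', hφ', hψ⟩ := h.exact (restrictTo (B.filter (y ∈ ·)) (coboundary K n φ))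
    (cochainsOn_mono (Finset.filter_subset _ _) (restrictTo_mem _ _)) (by
      intro c hc
      by_cases hyc : y ∈ c
      · rw [coboundary_restrictTo, coboundary_coboundary]
        intro k hk hkX
        by_cases hky : k = y
        · exact hky ▸ hlink c hc hyc
        · refine coboundary_eq_zero_of_mem hφ fun e he hec => hkX ((hX _).2 ⟨?_, ?_⟩)
          · refine h.mem_B c hc e he _ ?_ hec (Finset.erase_subset _ _)
            rw [Finset.card_erase_of_mem hk, h.card_C c hc]
            rfl
          · exact Finset.mem_erase.2 ⟨Ne.symm hky, hyc⟩
      · exact coboundary_eq_zero_of_mem (restrictTo_mem _ _)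
          fun b hb hbc => hyc (hbc ((hX b).1 hb).2))
  have hφ0 : φ' = 0 := by
    funext e
    by_cases he : e ∈ E
    · refine h.avoid y φ' hφ' (fun b hb hyb => ?_) e he (hy e he)
      rw [← hψ b hb]
      exact restrictTo_mem _ _ _ fun hb' => hyb ((hX b).1 hb').2
    · exact hφ' e he
  have h1 := hψ b hb
  rwa [hφ0, map_zero, restrictTo_apply_of_mem _ ((hX b).2 ⟨hb, hyb⟩)] at h1

theorem IsAcyclicTriple.false_of_cochain (h : IsAcyclicTriple K d E B C)
    (hC : ∀ c ∈ C, ∀ e ∈ E, e ⊆ c → ∃ e' ∈ E, e' ≠ e ∧ e' ⊆ c) {φ : Finset (Fin n) → K}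
    (hφ : φ ∈ cochainsOn K E) {m : Finset (Fin n)} (hm : m ∈ E) (hφm : φ m ≠ 0)
    {U : Finset (Fin n)} (hU : ∀ e ∈ E, e ⊆ U) {j : Fin n} (hj : j ∉ m)
    (htwo : ∀ b ∈ B, ∀ e ∈ E, ∀ e' ∈ E, e' ≠ e → e ⊆ b → e' ⊆ b → coboundary K n φ b = 0)
    (hjU : ∀ b ∈ B, j ∉ b → b ⊆ U → coboundary K n φ b = 0) : False := by
  refine hφm (h.avoid j φ hφ (fun b hb hjb => ?_) m hm hj)
  by_cases hbU : b ⊆ U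
  · exact hjU b hb hjb hbU
  obtain ⟨y, hyb, hyU⟩ := Finset.not_subset.1 hbU
  refine h.coboundary_eq_zero_of_link (fun e he hye => hyU (hU e he hye)) hφ ?_ hb hyb
  intro c hc hyc
  by_contra hne
  refine hne (coboundary_eq_zero_of_mem hφ fun e he hec => hne ?_)
  obtain ⟨e', he', hne', hec'⟩ := hC c hc e he (hec.trans (Finset.erase_subset _ _))
  refine htwo _ (h.mem_B c hc e he _ ?_ hec (Finset.erase_subset _ _)) e he e' he' hne' hec ?_
  · rw [Finset.card_erase_of_mem hyc, h.card_C c hc]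
    rfl
  · exact Finset.subset_erase.2 ⟨hec', fun hye => hyU (hU e' he' hye)⟩

theorem IsAcyclicTriple.false_of_forall_subset (h : IsAcyclicTriple K d E B C)
    (hC : ∀ c ∈ C, ∀ e ∈ E, e ⊆ c → ∃ e' ∈ E, e' ≠ e ∧ e' ⊆ c) {a m b : Finset (Fin n)}
    (ha : a ∈ E) (hm : m ∈ E) (ham : a ≠ m) (hb : b ∈ B) (hEb : ∀ e ∈ E, e ⊆ b) : False := by
  have hcard : ∀ e ∈ E, b.card = e.card + 1 := fun e he => by rw [h.card_B b hb, h.card_E e he]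
  have hσ := coboundary_single_ne_zero (K := K) (hEb a ha) (hcard a ha)
  obtain ⟨j, hjb, hjm⟩ := exists_erase_eq (hEb m hm) (hcard m hm)
  have hzero : coboundary K n (Pi.single m 1 - (coboundary K n (Pi.single m 1) b /
      coboundary K n (Pi.single a 1) b) • Pi.single a 1) b = 0 := by
    rw [map_sub, map_smul, Pi.sub_apply, Pi.smul_apply, smul_eq_mul, div_mul_cancel₀ _ hσ, sub_self]
  refine h.false_of_cochain hC (m := m) (U := b) (j := j) (sub_mem (single_mem_cochainsOn hm 1)
    (Submodule.smul_mem _ (coboundary K n (Pi.single m 1) b / coboundary K n (Pi.single a 1) b)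
      (single_mem_cochainsOn ha 1))) hm ?_ hEb ?_ ?_ ?_
  · simp [Pi.single_eq_of_ne ham.symm]
  · rw [← hjm]
    simp
  · intro b' hb' e he e' he' hne heb heb'
    rwa [eq_of_subset_of_subset (h.card_E e he) (h.card_E e' he') hne.symm (h.card_B b' hb')
      (h.card_B b hb) heb heb' (hEb e he) (hEb e' he')]
  · intro b' hb' hjb' hsub
    refine absurd (Finset.eq_of_subset_of_card_le hsub ?_ ▸ hjb) hjb'
    rw [h.card_B b hb, h.card_B b' hb']

theorem IsAcyclicTriple.false_of_path (h : IsAcyclicTriple K d E B C)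
    (hC : ∀ c ∈ C, ∀ e ∈ E, e ⊆ c → ∃ e' ∈ E, e' ≠ e ∧ e' ⊆ c) {a m z b₁ b₂ : Finset (Fin n)}
    (ha : a ∈ E) (hm : m ∈ E) (hz : z ∈ E) (hE : ∀ e ∈ E, e = a ∨ e = m ∨ e = z)
    (ham : a ≠ m) (hzm : z ≠ m) (hb₁ : b₁ ∈ B) (hb₂ : b₂ ∈ B) (hab : a ⊆ b₁) (hmb : m ⊆ b₁)
    (hmb' : m ⊆ b₂) (hzb : z ⊆ b₂) : False := by
  by_cases hzb₁ : z ⊆ b₁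
  · refine h.false_of_forall_subset hC ha hm ham hb₁ fun e he => ?_
    rcases hE e he with rfl | rfl | rfl <;> assumption
  by_cases hab₂ : a ⊆ b₂
  · refine h.false_of_forall_subset hC ha hm ham hb₂ fun e he => ?_
    rcases hE e he with rfl | rfl | rfl <;> assumption
  have hca := h.card_E a ha
  have hcm := h.card_E m hm
  have hcz := h.card_E z hz
  have hc₁ := h.card_B b₁ hb₁
  have hc₂ := h.card_B b₂ hb₂
  have hne : b₁ ≠ b₂ := by
    rintro rfl
    exact hzb₁ hzb
  have haz : a ≠ z := by
    rintro rfl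
    exact hab₂ hzb
  have hσ := coboundary_single_ne_zero (K := K) hab (by omega)
  have hτ := coboundary_single_ne_zero (K := K) hzb (by omega)
  obtain ⟨α, hα⟩ : ∃ α, α = coboundary K n (Pi.single m 1) b₁ /
    coboundary K n (Pi.single a 1) b₁ := ⟨_, rfl⟩
  obtain ⟨γ, hγ⟩ : ∃ γ, γ = coboundary K n (Pi.single m 1) b₂ /
    coboundary K n (Pi.single z 1) b₂ := ⟨_, rfl⟩
  obtain ⟨φ, hφ⟩ : ∃ φ : Finset (Fin n) → K,
    φ = Pi.single m 1 - α • Pi.single a 1 - γ • Pi.single z 1 := ⟨_, rfl⟩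
  have hφE : φ ∈ cochainsOn K E := by
    rw [hφ]
    exact sub_mem (sub_mem (single_mem_cochainsOn hm 1)
      (Submodule.smul_mem _ _ (single_mem_cochainsOn ha 1)))
      (Submodule.smul_mem _ _ (single_mem_cochainsOn hz 1))
  have hφb₁ : coboundary K n φ b₁ = 0 := by
    rw [hφ, map_sub, map_sub, map_smul, map_smul]
    simp only [Pi.sub_apply, Pi.smul_apply, smul_eq_mul]
    rw [hα, div_mul_cancel₀ _ hσ, coboundary_single_eq_zero 1 hzb₁]
    ring
  have hφb₂ : coboundary K n φ b₂ = 0 := by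
    rw [hφ, map_sub, map_sub, map_smul, map_smul]
    simp only [Pi.sub_apply, Pi.smul_apply, smul_eq_mul]
    rw [hγ, div_mul_cancel₀ _ hτ, coboundary_single_eq_zero 1 hab₂]
    ring
  have hU : (b₁ ∪ b₂).card = d + 2 := by
    have h1 := Finset.card_union_add_card_inter b₁ b₂
    have h2 := Finset.card_le_card (Finset.subset_inter hmb hmb')
    have h3 : (b₁ ∩ b₂).card < b₁.card := Finset.card_lt_card
      ⟨Finset.inter_subset_left, fun hsub => hne (Finset.eq_of_subset_of_card_le
        (hsub.trans Finset.inter_subset_right) (by omega))⟩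
    omega
  have hEU : ∀ e ∈ E, e ⊆ b₁ ∪ b₂ := by
    intro e he
    rcases hE e he with rfl | rfl | rfl
    · exact hab.trans Finset.subset_union_left
    · exact hmb.trans Finset.subset_union_left
    · exact hzb.trans Finset.subset_union_right
  have haz₀ : ∀ b ∈ B, a ⊆ b → z ⊆ b → coboundary K n φ b = 0 := by
    intro b hb hab' hzb'
    have hcb := h.card_B b hb
    have hbU : b ⊆ b₁ ∪ b₂ := by
      have hd : d < (a ∪ z).card := by
        rw [← hca]
        refine Finset.card_lt_card ⟨Finset.subset_union_left, fun hsub => haz ?_⟩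
        exact (Finset.eq_of_subset_of_card_le
          (Finset.subset_union_right.trans hsub) (by omega)).symm
      rw [← Finset.eq_of_subset_of_card_le (Finset.union_subset hab' hzb') (by omega)]
      exact Finset.union_subset (hEU a ha) (hEU z hz)
    refine eq_zero_of_coboundary_eq_zero hbU (by omega) (coboundary_coboundary φ _) ?_
    intro x hx hxc hxb
    by_contra hx0
    have hxc' : x.card = d + 1 := by omega
    have hx₁ : x ≠ b₁ := by
      rintro rfl
      exact hx0 hφb₁
    have hx₂ : x ≠ b₂ := by
      rintro rfl
      exact hx0 hφb₂
    refine hx0 (coboundary_eq_zero_of_mem hφE fun e he hex => ?_)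
    rcases hE e he with rfl | rfl | rfl
    · exact (eq_or_eq_of_card_eq hca hc₁ hcb hxc' hU hab hab' hex Finset.subset_union_left hbU hx
        (by rintro rfl; exact hzb₁ hzb')).elim hx₁ hxb
    · exact (eq_or_eq_of_card_eq hcm hc₁ hc₂ hxc' hU hmb hmb' hex Finset.subset_union_left
        Finset.subset_union_right hx hne).elim hx₁ hx₂
    · exact (eq_or_eq_of_card_eq hcz hc₂ hcb hxc' hU hzb hzb' hex Finset.subset_union_right hbU hx
        (by rintro rfl; exact hab₂ hab')).elim hx₂ hxb
  obtain ⟨j, hjb, hjm⟩ := exists_erase_eq hmb' (by omega)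
  have hjm' : j ∉ m := by
    rw [← hjm]
    simp
  refine h.false_of_cochain hC hφE hm ?_ hEU hjm' ?_ ?_
  · rw [hφ]
    simp [Pi.single_eq_of_ne ham.symm, Pi.single_eq_of_ne hzm.symm]
  · have hsymm : ∀ b ∈ B, ∀ e ∈ E, ∀ e' ∈ E, e' ≠ e → e ⊆ b → e' ⊆ b →
        (e = m ∨ e = a ∧ e' = z) → coboundary K n φ b = 0 := by
      intro b hb e he e' he' hne' heb heb' hcase
      have hcb := h.card_B b hb
      rcases hcase with rfl | ⟨rfl, rfl⟩
      · rcases hE e' he' with rfl | rfl | rfl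
        · rwa [eq_of_subset_of_subset hca hcm ham hcb hc₁ heb' heb hab hmb]
        · exact absurd rfl hne'
        · rwa [eq_of_subset_of_subset hcz hcm hzm hcb hc₂ heb' heb hzb hmb']
      · exact haz₀ b hb heb heb'
    intro b hb e he e' he' hne' heb heb'
    rcases hE e he with rfl | rfl | rfl
    · rcases hE e' he' with rfl | rfl | rfl
      · exact absurd rfl hne'
      · exact hsymm b hb _ he' _ he hne'.symm heb' heb (Or.inl rfl)
      · exact hsymm b hb _ he _ he' hne' heb heb' (Or.inr ⟨rfl, rfl⟩)
    · exact hsymm b hb _ he _ he' hne' heb heb' (Or.inl rfl)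
    · rcases hE e' he' with rfl | rfl | rfl
      · exact hsymm b hb _ he' _ he hne'.symm heb' heb (Or.inr ⟨rfl, rfl⟩)
      · exact hsymm b hb _ he' _ he hne'.symm heb' heb (Or.inl rfl)
      · exact absurd rfl hne'
  · intro b hb hjb' hbU
    have hsub : b ⊆ b₁ := by
      intro i hi
      rcases Finset.mem_union.1 (hbU hi) with h1 | h1
      · exact h1
      · refine hmb ?_
        rw [← hjm]
        exact Finset.mem_erase.2 ⟨fun hij => hjb' (hij ▸ hi), h1⟩
    rwa [Finset.eq_of_subset_of_card_le hsub (by rw [hc₁, h.card_B b hb])]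

theorem IsAcyclicTriple.false_of_card_le_three (h : IsAcyclicTriple K d E B C)
    (hC : ∀ c ∈ C, ∀ e ∈ E, e ⊆ c → ∃ e' ∈ E, e' ≠ e ∧ e' ⊆ c)
    (hB : ∀ e ∈ E, ∃ b ∈ B, e ⊆ b ∧ ∃ e' ∈ E, e' ≠ e ∧ e' ⊆ b) (hE : E.Nonempty)
    (hcard : E.card ≤ 3) : False := by
  obtain ⟨x, hx⟩ := hE
  obtain ⟨b₁, hb₁, hxb, y, hy, hyx, hyb⟩ := hB x hx
  by_cases hxy : ∀ e ∈ E, e = x ∨ e = y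
  · exact h.false_of_path hC hx hy hx (fun e he => by have := hxy e he; tauto) hyx.symm hyx.symm
      hb₁ hb₁ hxb hyb hyb hxb
  push Not at hxy
  obtain ⟨z, hz, hzx, hzy⟩ := hxy
  have hE3 : E = {x, y, z} := by
    symm
    apply Finset.eq_of_subset_of_card_le
    · simp [Finset.insert_subset_iff, hx, hy, hz]
    · rw [Finset.card_eq_three.2 ⟨x, y, z, hyx.symm, hzx.symm, hzy.symm, rfl⟩]
      exact hcard
  have hmem : ∀ e ∈ E, e = x ∨ e = y ∨ e = z := fun e he => by simpa [hE3] using he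
  obtain ⟨b₂, hb₂, hzb, w, hw, hwz, hwb⟩ := hB z hz
  rcases hmem w hw with rfl | rfl | rfl
  · exact h.false_of_path hC hy hx hz (fun e he => by have := hmem e he; tauto) hyx hzx
      hb₁ hb₂ hyb hxb hwb hzb
  · exact h.false_of_path hC hx hy hz hmem hyx.symm hzy hb₁ hb₂ hxb hyb hwb hzb
  · exact hwz rfl

end Contradiction

/-- An assignment `q` of an element of `C` to each element of `E ∪ B` whose fibres are the
Boolean intervals with upper endpoints in `C` of an interval partition of `E ∪ B ∪ C`. -/
structure IsIntervalMatching {α : Type*} [DecidableEq α] (E B C : Finset (Finset α))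
    (q : Finset α → Finset α) : Prop where
  mem_left : ∀ e ∈ E, q e ∈ C ∧ e ⊆ q e
  mem_right : ∀ b ∈ B, q b ∈ C ∧ b ⊆ q b
  between : ∀ e ∈ E, ∀ b ∈ B, e ⊆ b → b ⊆ q e → q b = q e
  subset_of_eq : ∀ e ∈ E, ∀ b ∈ B, q b = q e → e ⊆ b
  eq_or_exists : ∀ b ∈ B, ∀ b' ∈ B, q b = q b' → b = b' ∨ ∃ e ∈ E, q e = q b
  inj : ∀ e ∈ E, ∀ e' ∈ E, q e = q e' → e = e'

section Matching

variable {α : Type*} [DecidableEq α] {E B C E₁ B₁ C₁ E₂ B₂ C₂ : Finset (Finset α)}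
  {q q₁ q₂ : Finset α → Finset α}

theorem IsIntervalMatching.mono (h : IsIntervalMatching E B C₁ q) (hC : C₁ ⊆ C) :
    IsIntervalMatching E B C q :=
  { h with
    mem_left := fun e he => ⟨hC (h.mem_left e he).1, (h.mem_left e he).2⟩
    mem_right := fun b hb => ⟨hC (h.mem_right b hb).1, (h.mem_right b hb).2⟩ }

theorem isIntervalMatching_of_injOn (hq : ∀ b ∈ B, q b ∈ C ∧ b ⊆ q b) (hinj : Set.InjOn q B) :
    IsIntervalMatching ∅ B C q where
  mem_left := by simp
  mem_right := hq
  between := by simp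
  subset_of_eq := by simp
  eq_or_exists b hb b' hb' h := Or.inl (hinj hb hb' h)
  inj := by simp

theorem IsIntervalMatching.union (h₁ : IsIntervalMatching E₁ B₁ C₁ q₁)
    (h₂ : IsIntervalMatching E₂ B₂ C₂ q₂) (hC : Disjoint C₁ C₂)
    (hEB : Disjoint (E₁ ∪ B₁) (E₂ ∪ B₂))
    (hcross₁ : ∀ e ∈ E₁, ∀ b ∈ B₂, e ⊆ b → ¬ b ⊆ q₁ e)
    (hcross₂ : ∀ e ∈ E₂, ∀ b ∈ B₁, e ⊆ b → ¬ b ⊆ q₂ e) :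
    IsIntervalMatching (E₁ ∪ E₂) (B₁ ∪ B₂) (C₁ ∪ C₂)
      fun x => if x ∈ E₁ ∪ B₁ then q₁ x else q₂ x := by
  have hE₁ : ∀ e ∈ E₁, (if e ∈ E₁ ∪ B₁ then q₁ e else q₂ e) = q₁ e := fun e he =>
    if_pos (Finset.mem_union_left _ he)
  have hB₁ : ∀ e ∈ B₁, (if e ∈ E₁ ∪ B₁ then q₁ e else q₂ e) = q₁ e := fun e he =>
    if_pos (Finset.mem_union_right _ he)
  have hE₂ : ∀ e ∈ E₂, (if e ∈ E₁ ∪ B₁ then q₁ e else q₂ e) = q₂ e := fun e he =>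
    if_neg fun h => Finset.disjoint_left.1 hEB h (Finset.mem_union_left _ he)
  have hB₂ : ∀ e ∈ B₂, (if e ∈ E₁ ∪ B₁ then q₁ e else q₂ e) = q₂ e := fun e he =>
    if_neg fun h => Finset.disjoint_left.1 hEB h (Finset.mem_union_right _ he)
  have hne : ∀ c ∈ C₁, ∀ c' ∈ C₂, c ≠ c' := fun c hc c' hc' h =>
    Finset.disjoint_left.1 hC hc (h ▸ hc')
  refine ⟨fun e he => ?_, fun b hb => ?_, fun e he b hb heb => ?_, fun e he b hb => ?_,
    fun b hb b' hb' => ?_, fun e he e' he' => ?_⟩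
  · rcases Finset.mem_union.1 he with he | he
    · rw [hE₁ e he]
      exact ⟨Finset.mem_union_left _ (h₁.mem_left e he).1, (h₁.mem_left e he).2⟩
    · rw [hE₂ e he]
      exact ⟨Finset.mem_union_right _ (h₂.mem_left e he).1, (h₂.mem_left e he).2⟩
  · rcases Finset.mem_union.1 hb with hb | hb
    · rw [hB₁ b hb]
      exact ⟨Finset.mem_union_left _ (h₁.mem_right b hb).1, (h₁.mem_right b hb).2⟩
    · rw [hB₂ b hb]
      exact ⟨Finset.mem_union_right _ (h₂.mem_right b hb).1, (h₂.mem_right b hb).2⟩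
  · rcases Finset.mem_union.1 he with he | he <;> rcases Finset.mem_union.1 hb with hb | hb
    · rw [hE₁ e he, hB₁ b hb]
      exact h₁.between e he b hb heb
    · rw [hE₁ e he]
      exact fun hsub => absurd hsub (hcross₁ e he b hb heb)
    · rw [hE₂ e he]
      exact fun hsub => absurd hsub (hcross₂ e he b hb heb)
    · rw [hE₂ e he, hB₂ b hb]
      exact h₂.between e he b hb heb
  · rcases Finset.mem_union.1 he with he | he <;> rcases Finset.mem_union.1 hb with hb | hb
    · rw [hE₁ e he, hB₁ b hb]
      exact h₁.subset_of_eq e he b hb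
    · rw [hE₁ e he, hB₂ b hb]
      exact fun h => absurd h.symm (hne _ (h₁.mem_left e he).1 _ (h₂.mem_right b hb).1)
    · rw [hE₂ e he, hB₁ b hb]
      exact fun h => absurd h (hne _ (h₁.mem_right b hb).1 _ (h₂.mem_left e he).1)
    · rw [hE₂ e he, hB₂ b hb]
      exact h₂.subset_of_eq e he b hb
  · rcases Finset.mem_union.1 hb with hb | hb <;> rcases Finset.mem_union.1 hb' with hb' | hb'
    · rw [hB₁ b hb, hB₁ b' hb']
      refine fun h => (h₁.eq_or_exists b hb b' hb' h).imp_right ?_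
      rintro ⟨e, he, heq⟩
      exact ⟨e, Finset.mem_union_left _ he, (hE₁ e he).trans heq⟩
    · rw [hB₁ b hb, hB₂ b' hb']
      exact fun h => absurd h (hne _ (h₁.mem_right b hb).1 _ (h₂.mem_right b' hb').1)
    · rw [hB₂ b hb, hB₁ b' hb']
      exact fun h => absurd h.symm (hne _ (h₁.mem_right b' hb').1 _ (h₂.mem_right b hb).1)
    · rw [hB₂ b hb, hB₂ b' hb']
      refine fun h => (h₂.eq_or_exists b hb b' hb' h).imp_right ?_
      rintro ⟨e, he, heq⟩
      exact ⟨e, Finset.mem_union_right _ he, (hE₂ e he).trans heq⟩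
  · rcases Finset.mem_union.1 he with he | he <;> rcases Finset.mem_union.1 he' with he' | he'
    · rw [hE₁ e he, hE₁ e' he']
      exact h₁.inj e he e' he'
    · rw [hE₁ e he, hE₂ e' he']
      exact fun h => absurd h (hne _ (h₁.mem_left e he).1 _ (h₂.mem_left e' he').1)
    · rw [hE₂ e he, hE₁ e' he']
      exact fun h => absurd h.symm (hne _ (h₁.mem_left e' he').1 _ (h₂.mem_left e he).1)
    · rw [hE₂ e he, hE₂ e' he']
      exact h₂.inj e he e' he'

theorem isIntervalMatching_singleton {e v w c : Finset α} (hev : e ⊆ v) (hew : e ⊆ w)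
    (hvc : v ⊆ c) (hwc : w ⊆ c) : IsIntervalMatching {e} {v, w} {c} fun _ => c where
  mem_left := by simpa using hev.trans hvc
  mem_right := by simp [hvc, hwc]
  between := by simp
  subset_of_eq := by simp [hev, hew]
  eq_or_exists := by simp
  inj := by simp

end Matching

section Existence

variable {K : Type*} [Field K] {n : ℕ} {d : ℕ} {E B C : Finset (Finset (Fin n))}

theorem CoboundaryInjOn.mono {X Y D : Finset (Finset (Fin n))} (h : CoboundaryInjOn K Y D)
    (hXY : X ⊆ Y) : CoboundaryInjOn K X D :=
  fun ψ hψ hD => h ψ (cochainsOn_mono hXY hψ) hD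

theorem CoboundaryInjOn.erase {X D : Finset (Finset (Fin n))} (h : CoboundaryInjOn K X D)
    {c₀ : Finset (Fin n)} (hc₀ : ∀ b ∈ X, ¬ b ⊆ c₀) : CoboundaryInjOn K X (D.erase c₀) := by
  refine fun ψ hψ hD => h ψ hψ fun c hc => ?_
  by_cases hcc : c = c₀
  · rw [hcc]
    exact coboundary_eq_zero_of_mem hψ hc₀
  · exact hD c (Finset.mem_erase.2 ⟨hcc, hc⟩)

theorem IsAcyclicTriple.erase_mem (h : IsAcyclicTriple K d E B C) {e c : Finset (Fin n)}
    (he : e ∈ E) (hc : c ∈ C) {k : Fin n} (hk : k ∈ c) (hec : e ⊆ c.erase k) : c.erase k ∈ B := by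
  refine h.mem_B c hc e he _ ?_ hec (Finset.erase_subset _ _)
  rw [Finset.card_erase_of_mem hk, h.card_C c hc]
  rfl

theorem IsAcyclicTriple.exists_mem_of_mem (h : IsAcyclicTriple K d E B C) {e : Finset (Fin n)}
    (he : e ∈ E) : ∃ b ∈ B, e ⊆ b := by
  by_contra! hne
  have h1 : ∃ j, j ∉ e := by
    by_contra! hj
    have := h.card_E e he
    rw [Finset.eq_univ_iff_forall.2 hj, Finset.card_univ, Fintype.card_fin] at this
    exact h.lt.ne' this
  obtain ⟨j, hj⟩ := h1
  have h2 := h.avoid j (Pi.single e 1) (single_mem_cochainsOn he 1)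
    (fun b hb _ => coboundary_single_eq_zero 1 (hne b hb)) e he hj
  simp at h2

/-- Splitting off an element `e` of `E` that has a private neighbour `v` in `B`, one lying above no
other element of `E`. -/
theorem IsAcyclicTriple.exists_private_chain (h : IsAcyclicTriple K d E B C)
    {e v : Finset (Fin n)} (he : e ∈ E) (hv : v ∈ B) (hev : e ⊆ v)
    (hvE : ∀ e' ∈ E, e' ⊆ v → e' = e)
    (hcase : (∃ c₀ ∈ C, v ⊆ c₀ ∧ ∀ e' ∈ E, e' ⊆ c₀ → e' = e) ∨
      ∀ b ∈ B, e ⊆ b → ∀ e' ∈ E, e' ⊆ b → e' = e)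
    {B₁ B₂ : Finset (Finset (Fin n))}
    (hB₁ : ∀ b, b ∈ B₁ ↔ b ∈ B ∧ b ≠ v ∧ e ⊆ b ∧ ∀ e' ∈ E, e' ⊆ b → e' = e)
    (hB₂ : ∀ b, b ∈ B₂ ↔ b ∈ B ∧ ∃ e' ∈ E, e' ≠ e ∧ e' ⊆ b) :
    ∃ C₁ ⊆ C, ∃ C₂ ⊆ C, ∃ c₀ ∈ C, Disjoint C₁ C₂ ∧ c₀ ∉ C₂ ∧ v ⊆ c₀ ∧
      (∀ b ∈ B₂, e ⊆ b → ¬ b ⊆ c₀) ∧ CoboundaryInjOn K B₁ C₁ ∧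
      IsAcyclicTriple K d (E.erase e) B₂ C₂ := by
  have hvB₁ : v ∉ B₁ := fun h => ((hB₁ v).1 h).2.1 rfl
  have hvB₂ : v ∉ B₂ := fun h => by
    obtain ⟨-, e', he', hne, hsub⟩ := (hB₂ v).1 h
    exact hne (hvE e' he' hsub)
  obtain ⟨C₁, hC₁, C₂, hC₂, hdis, hinj, htriple⟩ := h.exists_split
    (E₂ := E.erase e) (B₁ := B₁) (B₂ := B₂) (Finset.erase_subset _ _)
    (fun b hb => ((hB₁ b).1 hb).1) (fun b hb => ((hB₂ b).1 hb).1)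
    (Finset.disjoint_left.2 fun b hb₁ hb₂ => by
      obtain ⟨-, e', he', hne, hsub⟩ := (hB₂ b).1 hb₂
      exact hne (((hB₁ b).1 hb₁).2.2.2 e' he' hsub))
    (fun e' he' b hb hsub => (hB₂ b).2
      ⟨hb, e', Finset.mem_of_mem_erase he', Finset.ne_of_mem_erase he', hsub⟩)
    (by
      intro φ hφ hφB T hT
      by_cases hTe : T = e
      · subst hTe
        refine eq_zero_of_coboundary_eq_zero hev ?_ (hφB v hv hvB₁ hvB₂) ?_
        · rw [h.card_B v hv, h.card_E T he]
        · intro e' he'v _ hne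
          exact hφ e' fun he' => hne (hvE e' he' he'v)
      · exact hφ T fun hTE => hT (Finset.mem_erase.2 ⟨hTe, hTE⟩))
  rcases hcase with ⟨c₀, hc₀, hvc₀, hc₀E⟩ | hpriv
  · have hB₂c₀ : ∀ b ∈ B₂, ¬ b ⊆ c₀ := by
      intro b hb hbc
      obtain ⟨-, e', he', hne, hsub⟩ := (hB₂ b).1 hb
      exact hne (hc₀E e' he' (hsub.trans hbc))
    exact ⟨C₁, hC₁, C₂.erase c₀, (Finset.erase_subset _ _).trans hC₂, c₀, hc₀,
      hdis.mono_right (Finset.erase_subset _ _), by simp, hvc₀, fun b hb _ => hB₂c₀ b hb, hinj,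
      htriple.erase hB₂c₀⟩
  · obtain ⟨c₀, hc₀, hvc₀⟩ : ∃ c₀ ∈ C₁, v ⊆ c₀ := by
      by_contra! hne
      have hψ := hinj (restrictTo B₁ (coboundary K n (Pi.single e 1))) (restrictTo_mem _ _) (by
        intro c hc
        rw [coboundary_restrictTo, coboundary_coboundary]
        intro k hk hkB₁
        by_contra hne0
        have hek : e ⊆ c.erase k := by
          by_contra hek
          exact hne0 (coboundary_single_eq_zero 1 hek)
        have hkB := h.erase_mem he (hC₁ hc) hk hek
        refine hkB₁ ((hB₁ _).2 ⟨hkB, ?_, hek, hpriv _ hkB hek⟩)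
        intro hkv
        exact hne c hc (hkv ▸ Finset.erase_subset _ _))
      obtain ⟨j, hj, hje⟩ := exists_erase_eq hev (by rw [h.card_B v hv, h.card_E e he])
      have h1 := h.avoid j (Pi.single e 1) (single_mem_cochainsOn he 1) (fun b hb hjb => ?_) e he
        (by rw [← hje]; simp)
      · simp at h1
      · by_cases heb : e ⊆ b
        · have hbB₁ : b ∈ B₁ := (hB₁ b).2
            ⟨hb, fun hbv => hjb (hbv ▸ hj), heb, hpriv b hb heb⟩
          have h2 := congrFun hψ b
          rwa [restrictTo_apply_of_mem _ hbB₁] at h2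
        · exact coboundary_single_eq_zero 1 heb
    refine ⟨C₁, hC₁, C₂, hC₂, c₀, hC₁ hc₀, hdis, Finset.disjoint_left.1 hdis hc₀, hvc₀, ?_,
      hinj, htriple⟩
    intro b hb heb
    obtain ⟨hbB, e', he', hne, hsub⟩ := (hB₂ b).1 hb
    exact absurd (hpriv b hbB heb e' he' hsub) hne

open Classical in
theorem IsAcyclicTriple.exists_matching_of_private (h : IsAcyclicTriple K d E B C)
    (hcov : ∀ b ∈ B, ∃ e ∈ E, e ⊆ b) {e v : Finset (Fin n)} (he : e ∈ E) (hv : v ∈ B) (hev : e ⊆ v)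
    (hvE : ∀ e' ∈ E, e' ⊆ v → e' = e)
    (hcase : (∃ c₀ ∈ C, v ⊆ c₀ ∧ ∀ e' ∈ E, e' ⊆ c₀ → e' = e) ∨
      ∀ b ∈ B, e ⊆ b → ∀ e' ∈ E, e' ⊆ b → e' = e)
    (ih : ∀ B₂ C₂ : Finset (Finset (Fin n)), IsAcyclicTriple K d (E.erase e) B₂ C₂ →
      (∀ b ∈ B₂, ∃ e' ∈ E.erase e, e' ⊆ b) →
      ∃ q, IsIntervalMatching (E.erase e) B₂ C₂ q) :
    ∃ q, IsIntervalMatching E B C q := by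
  obtain ⟨B₁, hB₁⟩ : ∃ B₁ : Finset (Finset (Fin n)), ∀ b, b ∈ B₁ ↔
      b ∈ B ∧ b ≠ v ∧ e ⊆ b ∧ ∀ e' ∈ E, e' ⊆ b → e' = e :=
    ⟨B.filter fun b => b ≠ v ∧ e ⊆ b ∧ ∀ e' ∈ E, e' ⊆ b → e' = e, fun b => Finset.mem_filter⟩
  obtain ⟨B₂, hB₂⟩ : ∃ B₂ : Finset (Finset (Fin n)), ∀ b, b ∈ B₂ ↔
      b ∈ B ∧ ∃ e' ∈ E, e' ≠ e ∧ e' ⊆ b :=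
    ⟨B.filter fun b => ∃ e' ∈ E, e' ≠ e ∧ e' ⊆ b, fun b => Finset.mem_filter⟩
  obtain ⟨C₁, hC₁, C₂, hC₂, c₀, hc₀, hdis, hc₀C₂, hvc₀, hB₂c₀, hinj, htriple⟩ :=
    h.exists_private_chain he hv hev hvE hcase hB₁ hB₂
  obtain ⟨q₂, hq₂⟩ := ih B₂ C₂ htriple fun b hb => by
    obtain ⟨-, e', he', hne, hsub⟩ := (hB₂ b).1 hb
    exact ⟨e', Finset.mem_erase.2 ⟨hne, he'⟩, hsub⟩
  have hce := h.card_E e he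
  have hcv := h.card_B v hv
  have hcc := h.card_C c₀ hc₀
  obtain ⟨i, hi, hie⟩ := exists_erase_eq hev (by omega)
  have hie' : i ∉ e := by
    rw [← hie]
    simp
  have hew : e ⊆ c₀.erase i := Finset.subset_erase.2 ⟨hev.trans hvc₀, hie'⟩
  have hw : c₀.erase i ∈ B := h.erase_mem he hc₀ (hvc₀ hi) hew
  have hvw : v ≠ c₀.erase i := by
    intro heq
    rw [heq] at hi
    simp at hi
  have hbetween : ∀ b ∈ B, e ⊆ b → b ⊆ c₀ → b = v ∨ b = c₀.erase i := fun b hb heb hbc =>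
    eq_or_eq_of_card_eq hce hcv (h.card_B _ hw) (h.card_B b hb) hcc hev hew heb hvc₀
      (Finset.erase_subset _ _) hbc hvw
  have hwE : ∀ e' ∈ E, e' ⊆ c₀.erase i → e' = e := by
    intro e' he' hsub
    by_contra hne
    exact hB₂c₀ _ ((hB₂ _).2 ⟨hw, e', he', hne, hsub⟩) hew (Finset.erase_subset _ _)
  have hpair : ∀ b ∈ ({v, c₀.erase i} : Finset (Finset (Fin n))),
      b ∈ B ∧ e ⊆ b ∧ ∀ e' ∈ E, e' ⊆ b → e' = e := by
    intro b hb
    rcases Finset.mem_insert.1 hb with rfl | hb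
    · exact ⟨hv, hev, hvE⟩
    · rw [Finset.mem_singleton.1 hb]
      exact ⟨hw, hew, hwE⟩
  obtain ⟨q₁, hq₁, hq₁inj⟩ := ((hinj.mono (Finset.erase_subset (c₀.erase i) B₁)).erase
    (c₀ := c₀) (by
      intro b hb hbc
      obtain ⟨hbw, hb₁⟩ := Finset.mem_erase.1 hb
      obtain ⟨hbB, hbv, heb, -⟩ := (hB₁ b).1 hb₁
      exact (hbetween b hbB heb hbc).elim hbv hbw)).exists_injOn
  have hm₁ := isIntervalMatching_of_injOn hq₁ hq₁inj
  have hm₀ := isIntervalMatching_singleton hev hew hvc₀ (Finset.erase_subset i c₀)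
  have hB₁' : ∀ b ∈ B₁.erase (c₀.erase i), b ∈ B ∧ b ≠ v ∧ b ≠ c₀.erase i ∧ e ⊆ b ∧
      ∀ e' ∈ E, e' ⊆ b → e' = e := fun b hb => by
    obtain ⟨hbw, hb₁⟩ := Finset.mem_erase.1 hb
    obtain ⟨hbB, hbv, heb, hbE⟩ := (hB₁ b).1 hb₁
    exact ⟨hbB, hbv, hbw, heb, hbE⟩
  have hEB : ∀ b ∈ B, b ∉ E := fun b hb hbE => by
    have h1 := h.card_B b hb
    have h2 := h.card_E b hbE
    omega
  have hm₀₁ := hm₀.union hm₁ (by simp)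
    (by
      rw [Finset.disjoint_left]
      intro x hx hx'
      obtain ⟨hxB, hxv, hxw, -⟩ := hB₁' x (by simpa using hx')
      rcases Finset.mem_union.1 hx with hx | hx
      · rw [Finset.mem_singleton.1 hx] at hxB
        exact hEB e hxB he
      · rcases Finset.mem_insert.1 hx with rfl | hx
        · exact hxv rfl
        · exact hxw (Finset.mem_singleton.1 hx))
    (by
      intro e' _ b hb _ hbc
      obtain ⟨hbB, hbv, hbw, heb, -⟩ := hB₁' b hb
      exact (hbetween b hbB heb hbc).elim hbv hbw)
    (by simp)
  have hpriv : ∀ b ∈ {v, c₀.erase i} ∪ B₁.erase (c₀.erase i),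
      b ∈ B ∧ e ⊆ b ∧ ∀ e' ∈ E, e' ⊆ b → e' = e := by
    intro b hb
    rcases Finset.mem_union.1 hb with hb | hb
    · exact hpair b hb
    · obtain ⟨hbB, -, -, heb, hbE⟩ := hB₁' b hb
      exact ⟨hbB, heb, hbE⟩
  have hm := hm₀₁.union hq₂
    (by
      rw [Finset.disjoint_union_left, Finset.disjoint_singleton_left]
      exact ⟨hc₀C₂, hdis.mono_left (Finset.erase_subset _ _)⟩)
    (by
      rw [Finset.disjoint_left]
      intro x hx hx'
      have hxe : x ∈ B₂ → ∃ e' ∈ E, e' ≠ e ∧ e' ⊆ x := fun h => ((hB₂ x).1 h).2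
      have hxB : x ∈ B₂ → x ∈ B := fun h => ((hB₂ x).1 h).1
      rcases Finset.mem_union.1 hx with hx | hx
      · obtain rfl : x = e := by simpa using hx
        rcases Finset.mem_union.1 hx' with hx' | hx'
        · simp at hx'
        · exact hEB x (hxB hx') he
      · obtain ⟨hxB', -, hxE⟩ := hpriv x hx
        rcases Finset.mem_union.1 hx' with hx' | hx'
        · exact hEB x hxB' (Finset.mem_of_mem_erase hx')
        · obtain ⟨e', he', hne, hsub⟩ := hxe hx'
          exact hne (hxE e' he' hsub))
    (by
      intro e' he' b hb heb
      obtain rfl : e' = e := by simpa using he'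
      simpa using hB₂c₀ b hb heb)
    (by
      intro e' he' b hb heb _
      exact Finset.ne_of_mem_erase he'
        ((hpriv b hb).2.2 e' (Finset.mem_of_mem_erase he') heb))
  have hE : {e} ∪ ∅ ∪ E.erase e = E := by
    rw [Finset.union_empty, ← Finset.insert_eq, Finset.insert_erase he]
  have hB : {v, c₀.erase i} ∪ B₁.erase (c₀.erase i) ∪ B₂ = B := by
    ext b
    constructor
    · intro hb
      rcases Finset.mem_union.1 hb with hb | hb
      · exact (hpriv b hb).1
      · exact ((hB₂ b).1 hb).1
    · intro hb
      by_cases hbE : ∃ e' ∈ E, e' ≠ e ∧ e' ⊆ b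
      · exact Finset.mem_union_right _ ((hB₂ b).2 ⟨hb, hbE⟩)
      push Not at hbE
      have hbE' : ∀ e' ∈ E, e' ⊆ b → e' = e := fun e' he' hsub => by
        by_contra hne
        exact hbE e' he' hne hsub
      obtain ⟨e', he', hsub⟩ := hcov b hb
      rw [hbE' e' he' hsub] at hsub
      refine Finset.mem_union_left _ ?_
      by_cases hbv : b = v
      · simp [hbv]
      by_cases hbw : b = c₀.erase i
      · simp [hbw]
      exact Finset.mem_union_right _
        (Finset.mem_erase.2 ⟨hbw, (hB₁ b).2 ⟨hb, hbv, hsub, hbE'⟩⟩)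
  rw [hE, hB] at hm
  refine ⟨_, hm.mono ?_⟩
  refine Finset.union_subset (Finset.union_subset (by simpa using hc₀) ?_) hC₂
  exact (Finset.erase_subset _ _).trans hC₁

theorem IsAcyclicTriple.exists_matching_of_cover (hcard : E.card ≤ 3)
    (h : IsAcyclicTriple K d E B C) (hcov : ∀ b ∈ B, ∃ e ∈ E, e ⊆ b) :
    ∃ q, IsIntervalMatching E B C q := by
  induction hk : E.card generalizing E B C with
  | zero =>
    rw [Finset.card_eq_zero] at hk
    subst hk
    have hB : B = ∅ := Finset.eq_empty_of_forall_notMem fun b hb => by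
      simpa using hcov b hb
    subst hB
    exact ⟨id, isIntervalMatching_of_injOn (by simp) (by simp)⟩
  | succ k ih =>
    have ih' : ∀ e ∈ E, ∀ B₂ C₂ : Finset (Finset (Fin n)), IsAcyclicTriple K d (E.erase e) B₂ C₂ →
        (∀ b ∈ B₂, ∃ e' ∈ E.erase e, e' ⊆ b) →
        ∃ q, IsIntervalMatching (E.erase e) B₂ C₂ q := by
      intro e he B₂ C₂ h₂ hcov₂
      have := Finset.card_erase_of_mem he
      exact ih (by omega) h₂ hcov₂ (by omega)
    by_contra hno
    refine h.false_of_card_le_three ?_ ?_ (Finset.card_pos.1 (by omega)) hcard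
    · intro c hc e he hec
      by_contra! hne
      have hce : ∀ e' ∈ E, e' ⊆ c → e' = e := fun e' he' hsub => by
        by_contra hne'
        exact hne e' he' hne' hsub
      obtain ⟨k, hk, hke⟩ : ∃ k ∈ c, k ∉ e := by
        by_contra! hsub
        have h1 := Finset.card_le_card (show c ⊆ e from hsub)
        rw [h.card_C c hc, h.card_E e he] at h1
        omega
      have hek : e ⊆ c.erase k := Finset.subset_erase.2 ⟨hec, hke⟩
      exact hno (h.exists_matching_of_private hcov he (h.erase_mem he hc hk hek) hek
        (fun e' he' hsub => hce e' he' (hsub.trans (Finset.erase_subset _ _)))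
        (Or.inl ⟨c, hc, Finset.erase_subset _ _, hce⟩) (ih' e he))
    · intro e he
      by_contra! hne
      have hbE : ∀ b ∈ B, e ⊆ b → ∀ e' ∈ E, e' ⊆ b → e' = e := fun b hb heb e' he' hsub => by
        by_contra hne'
        exact hne b hb heb e' he' hne' hsub
      obtain ⟨v, hv, hev⟩ := h.exists_mem_of_mem he
      exact hno (h.exists_matching_of_private hcov he hv hev (hbE v hv hev) (Or.inr hbE)
        (ih' e he))

open Classical in
theorem IsAcyclicTriple.exists_matching (hcard : E.card ≤ 3) (h : IsAcyclicTriple K d E B C) :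
    ∃ q, IsIntervalMatching E B C q := by
  have hmem : ∀ b, b ∈ B.filter (fun b => ∃ e ∈ E, e ⊆ b) ↔ b ∈ B ∧ ∃ e ∈ E, e ⊆ b :=
    fun b => Finset.mem_filter
  have hmem' : ∀ b, b ∈ B.filter (fun b => ¬ ∃ e ∈ E, e ⊆ b) ↔ b ∈ B ∧ ¬ ∃ e ∈ E, e ⊆ b :=
    fun b => Finset.mem_filter
  obtain ⟨C₁, hC₁, C₂, hC₂, hdis, hinj, htriple⟩ := h.exists_split (E₂ := E)
    (B₁ := B.filter fun b => ¬ ∃ e ∈ E, e ⊆ b) (B₂ := B.filter fun b => ∃ e ∈ E, e ⊆ b)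
    subset_rfl (Finset.filter_subset _ _) (Finset.filter_subset _ _)
    (Finset.disjoint_left.2 fun b hb hb' => ((hmem' b).1 hb).2 ((hmem b).1 hb').2)
    (fun e he b hb heb => (hmem b).2 ⟨hb, e, he, heb⟩) (fun φ hφ _ => hφ)
  obtain ⟨q₂, hq₂⟩ := htriple.exists_matching_of_cover hcard fun b hb => ((hmem b).1 hb).2
  obtain ⟨q₁, hq₁, hq₁inj⟩ := hinj.exists_injOn
  have hm := (isIntervalMatching_of_injOn hq₁ hq₁inj).union hq₂ hdis
    (by
      rw [Finset.disjoint_left]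
      intro b hb hb'
      have hb := (hmem' b).1 (by simpa using hb)
      rcases Finset.mem_union.1 hb' with hb' | hb'
      · exact hb.2 ⟨b, hb', subset_rfl⟩
      · exact hb.2 ((hmem b).1 hb').2)
    (by simp)
    (fun e he b hb heb _ => ((hmem' b).1 hb).2 ⟨e, he, heb⟩)
  have hB : (B.filter fun b => ¬ ∃ e ∈ E, e ⊆ b) ∪ (B.filter fun b => ∃ e ∈ E, e ⊆ b) = B := by
    ext b
    rw [Finset.mem_union, hmem, hmem']
    tauto
  rw [Finset.empty_union, hB] at hm
  exact ⟨_, hm.mono (Finset.union_subset hC₁ hC₂)⟩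

end Existence

section Apex

variable {K : Type*} [Field K] {n : ℕ} {d : ℕ} {E B C : Finset (Finset (Fin n))}

theorem eq_of_subset_insert {α : Type*} [DecidableEq α] {t : α} {a b : Finset α}
    (hab : a ⊆ insert t b) (ht : t ∉ a) (hcard : a.card = b.card) : a = b :=
  Finset.eq_of_subset_of_card_le ((Finset.subset_insert_iff_of_notMem ht).1 hab) hcard.ge

/-- The generators `e` with `e ∪ {t}` in `B` inject into the link of `t` in `C`. -/
theorem IsAcyclicTriple.exists_injOn_link (h : IsAcyclicTriple K d E B C) {t : Fin n}
    (ht : ∀ e ∈ E, t ∉ e) {E₁ : Finset (Finset (Fin n))}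
    (hE₁ : ∀ e, e ∈ E₁ ↔ e ∈ E ∧ insert t e ∈ B) :
    ∃ g : Finset (Fin n) → Finset (Fin n),
      (∀ e ∈ E₁, (g e ∈ B ∧ t ∉ g e ∧ insert t (g e) ∈ C) ∧ e ⊆ g e) ∧ Set.InjOn g E₁ := by
  have hlk : ∀ b, b ∈ B.filter (fun b => t ∉ b ∧ insert t b ∈ C) ↔
      b ∈ B ∧ t ∉ b ∧ insert t b ∈ C := fun b => Finset.mem_filter
  have hinj : CoboundaryInjOn K E₁ (B.filter fun b => t ∉ b ∧ insert t b ∈ C) := by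
    intro φ hφ hφlk
    have hφE : φ ∈ cochainsOn K E := cochainsOn_mono (fun e he => ((hE₁ e).1 he).1) hφ
    funext e
    by_cases he : e ∈ E₁
    · obtain ⟨heE, heB⟩ := (hE₁ e).1 he
      have h1 := h.coboundary_eq_zero_of_link ht hφE (fun c hc htc => by
        by_contra hne
        refine hne (hφlk _ ((hlk _).2 ⟨?_, by simp, by rwa [Finset.insert_erase htc]⟩))
        by_contra hB
        exact hne (coboundary_eq_zero_of_mem hφE fun e he hec => hB (h.erase_mem he hc htc hec)))
        heB (Finset.mem_insert_self _ _)
      refine eq_zero_of_coboundary_eq_zero (Finset.subset_insert _ _)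
        (Finset.card_insert_of_notMem (ht e heE)) h1 fun e' he' _ hne => hφE e' fun he'E => hne ?_
      exact eq_of_subset_insert he' (ht e' he'E) (by rw [h.card_E e heE, h.card_E e' he'E])
    · exact hφ e he
  obtain ⟨g, hg, hginj⟩ := hinj.exists_injOn
  exact ⟨g, fun e he => ⟨(hlk _).1 (hg e he).1, (hg e he).2⟩, hginj⟩

theorem IsAcyclicTriple.exists_matching_of_apex (h : IsAcyclicTriple K d E B C)
    (hcov : ∀ b ∈ B, ∃ e ∈ E, e ⊆ b) (hcard : E.card ≤ 4) {t : Fin n} (ht : ∀ e ∈ E, t ∉ e)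
    {c e₀ : Finset (Fin n)} (hc : c ∈ C) (htc : t ∈ c) (he₀ : e₀ ∈ E) (hec : e₀ ⊆ c) :
    ∃ q, IsIntervalMatching E B C q := by
  have hE₁ : ∀ e, e ∈ E.filter (fun e => insert t e ∈ B) ↔ e ∈ E ∧ insert t e ∈ B :=
    fun e => Finset.mem_filter
  obtain ⟨E₁, hE₁⟩ : ∃ E₁ : Finset (Finset (Fin n)), ∀ e, e ∈ E₁ ↔ e ∈ E ∧ insert t e ∈ B :=
    ⟨_, hE₁⟩
  obtain ⟨g, hg, hginj⟩ := h.exists_injOn_link ht hE₁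
  have hcard_insert : ∀ e ∈ E, (insert t e).card = d + 1 := fun e he => by
    rw [Finset.card_insert_of_notMem (ht e he), h.card_E e he]
  have hsub : ∀ e ∈ E, ∀ e' ∈ E, e ⊆ insert t e' → e = e' := fun e he e' he' hs =>
    eq_of_subset_insert hs (ht e he) (by rw [h.card_E e he, h.card_E e' he'])
  have hlink : ∀ e ∈ E, ∀ e' ∈ E₁, e ⊆ g e' → e ∈ E₁ := by
    intro e he e' he' hs
    refine (hE₁ e).2 ⟨he, h.mem_B _ (hg e' he').1.2.2 e he _ (hcard_insert e he)
      (Finset.subset_insert _ _) (Finset.insert_subset_insert _ hs)⟩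
  have hgsub : ∀ b ∈ B, t ∉ b → ∀ e ∈ E₁, b ⊆ insert t (g e) → b = g e := fun b hb htb e he hs =>
    eq_of_subset_insert hs htb (by rw [h.card_B b hb, h.card_B _ (hg e he).1.1])
  have hcover : ∀ b ∈ B, t ∈ b → ∃ e ∈ E₁, insert t e = b := by
    intro b hb htb
    obtain ⟨e, he, heb⟩ := hcov b hb
    have heq : insert t e = b := Finset.eq_of_subset_of_card_le
      (Finset.insert_subset htb heb) (by rw [hcard_insert e he, h.card_B b hb])
    exact ⟨e, (hE₁ e).2 ⟨he, heq ▸ hb⟩, heq⟩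
  have hEB : ∀ b ∈ B, b ∉ E := fun b hb hbE => by
    have h1 := h.card_B b hb
    have h2 := h.card_E b hbE
    omega
  have hE₁E : E₁ ⊆ E := fun e he => ((hE₁ e).1 he).1
  have hB₁ : ∀ b ∈ E₁.image (insert t) ∪ E₁.image g,
      b ∈ B ∧ ∃ e ∈ E₁, b = insert t e ∨ b = g e := by
    intro b hb
    rcases Finset.mem_union.1 hb with hb | hb <;> obtain ⟨e, he, rfl⟩ := Finset.mem_image.1 hb
    · exact ⟨((hE₁ e).1 he).2, e, he, Or.inl rfl⟩
    · exact ⟨(hg e he).1.1, e, he, Or.inr rfl⟩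
  have hR : E₁.image (fun e => insert t (g e)) ⊆ C := by
    intro c hc
    obtain ⟨e, he, rfl⟩ := Finset.mem_image.1 hc
    exact (hg e he).1.2.2
  obtain ⟨B₂, hB₂⟩ : ∃ B₂ : Finset (Finset (Fin n)), ∀ b, b ∈ B₂ ↔
      b ∈ B ∧ t ∉ b ∧ ∀ e ∈ E₁, b ≠ g e :=
    ⟨B.filter fun b => t ∉ b ∧ ∀ e ∈ E₁, b ≠ g e, fun b => Finset.mem_filter⟩
  have htriple : IsAcyclicTriple K d (E \ E₁) B₂
      (C \ E₁.image fun e => insert t (g e)) := by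
    refine ⟨h.lt, fun e he => h.card_E e (Finset.sdiff_subset he),
      fun b hb => h.card_B b ((hB₂ b).1 hb).1, fun c hc => h.card_C c (Finset.sdiff_subset hc),
      ?_, ?_, ?_⟩
    · intro c hc e he b hb heb hbc
      obtain ⟨heE, heE₁⟩ := Finset.mem_sdiff.1 he
      have hbB := h.mem_B c (Finset.sdiff_subset hc) e heE b hb heb hbc
      refine (hB₂ b).2 ⟨hbB, fun htb => ?_, fun e' he' hbg => ?_⟩
      · obtain ⟨e', he', rfl⟩ := hcover b hbB htb
        exact heE₁ (hsub e heE e' (hE₁E he') heb ▸ he')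
      · exact heE₁ (hlink e heE e' he' (hbg ▸ heb))
    · intro ψ hψ hψC
      obtain ⟨φ, hφ, hφB⟩ := h.exact ψ
        (cochainsOn_mono (X := B₂) (fun b hb => ((hB₂ b).1 hb).1) hψ) (by
          intro c hc
          by_cases hcR : c ∈ E₁.image fun e => insert t (g e)
          · obtain ⟨e, he, rfl⟩ := Finset.mem_image.1 hcR
            refine coboundary_eq_zero_of_mem (X := B₂) hψ fun b hb hbc => ?_
            obtain ⟨hbB, htb, hbg⟩ := (hB₂ b).1 hb
            exact hbg e he (hgsub b hbB htb e he hbc)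
          · exact hψC c (Finset.mem_sdiff.2 ⟨hc, hcR⟩))
      refine ⟨φ, fun e he => ?_, fun b hb => hφB b ((hB₂ b).1 hb).1⟩
      by_cases heE : e ∈ E
      · have heE₁ : e ∈ E₁ := by
          by_contra hne
          exact he (Finset.mem_sdiff.2 ⟨heE, hne⟩)
        have h1 := hφB _ ((hE₁ e).1 heE₁).2
        rw [hψ _ fun hb => ((hB₂ _).1 hb).2.1 (Finset.mem_insert_self _ _)] at h1
        exact eq_zero_of_coboundary_eq_zero (Finset.subset_insert _ _)
          (Finset.card_insert_of_notMem (ht e heE)) h1.symm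
          fun e' he' _ hne => hφ e' fun he'E => hne (hsub e' he'E e heE he')
      · exact hφ e heE
    · intro j φ hφ hφB e he hje
      refine h.avoid j φ (cochainsOn_mono (X := E \ E₁) Finset.sdiff_subset hφ)
        (fun b hb hjb => ?_) e (Finset.sdiff_subset he) hje
      by_cases hbB₂ : b ∈ B₂
      · exact hφB b hbB₂ hjb
      refine coboundary_eq_zero_of_mem (X := E \ E₁) hφ fun e he heb => hbB₂ ?_
      obtain ⟨heE, heE₁⟩ := Finset.mem_sdiff.1 he
      refine (hB₂ b).2 ⟨hb, fun htb => ?_, fun e' he' hbg => ?_⟩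
      · obtain ⟨e', he', rfl⟩ := hcover b hb htb
        exact heE₁ (hsub e heE e' (hE₁E he') heb ▸ he')
      · exact heE₁ (hlink e heE e' he' (hbg ▸ heb))
  have he₀E₁ : e₀ ∈ E₁ := (hE₁ e₀).2 ⟨he₀, h.mem_B c hc e₀ he₀ _ (hcard_insert e₀ he₀)
    (Finset.subset_insert _ _) (Finset.insert_subset htc hec)⟩
  have hcard₂ : (E \ E₁).card ≤ 3 := by
    have h1 := Finset.card_pos.2 ⟨e₀, he₀E₁⟩
    rw [Finset.card_sdiff_of_subset hE₁E]
    omega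
  obtain ⟨q₂, hq₂⟩ := htriple.exists_matching hcard₂
  have hm : IsIntervalMatching E₁ (E₁.image (insert t) ∪ E₁.image g)
      (E₁.image fun e => insert t (g e)) fun x => if t ∈ x then insert t (g (x.erase t))
        else if x ∈ E then insert t (g x) else insert t x := by
    have hq₁ : ∀ e ∈ E₁, (if t ∈ e then insert t (g (e.erase t))
        else if e ∈ E then insert t (g e) else insert t e) = insert t (g e) := fun e he => by
      rw [if_neg (ht e (hE₁E he)), if_pos (hE₁E he)]
    have hq₁' : ∀ b, ∀ e ∈ E₁, (b = insert t e ∨ b = g e) →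
        (if t ∈ b then insert t (g (b.erase t))
        else if b ∈ E then insert t (g b) else insert t b) = insert t (g e) := by
      rintro b e he (rfl | rfl)
      · rw [if_pos (Finset.mem_insert_self _ _), Finset.erase_insert (ht e (hE₁E he))]
      · rw [if_neg (hg e he).1.2.1, if_neg (hEB _ (hg e he).1.1)]
    have hinj : ∀ e ∈ E₁, ∀ e' ∈ E₁, insert t (g e) = insert t (g e') → e = e' := by
      intro e he e' he' heq
      exact hginj he he' (hgsub _ (hg e he).1.1 (hg e he).1.2.1 e' he'
        (heq ▸ Finset.subset_insert _ _))
    refine ⟨fun e he => ?_, fun b hb => ?_, fun e he b hb heb hbq => ?_, fun e he b hb heq => ?_,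
      fun b hb b' hb' heq => ?_, fun e he e' he' heq => ?_⟩
    · rw [hq₁ e he]
      exact ⟨Finset.mem_image_of_mem _ he, (hg e he).2.trans (Finset.subset_insert _ _)⟩
    · obtain ⟨-, e, he, hbe⟩ := hB₁ b hb
      rw [hq₁' b e he hbe]
      refine ⟨Finset.mem_image_of_mem _ he, ?_⟩
      rcases hbe with rfl | rfl
      · exact Finset.insert_subset_insert _ (hg e he).2
      · exact Finset.subset_insert _ _
    · obtain ⟨-, e', he', hbe⟩ := hB₁ b hb
      rw [hq₁ e he] at hbq ⊢
      rw [hq₁' b e' he' hbe]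
      rcases hbe with rfl | rfl
      · rw [hsub e (hE₁E he) e' (hE₁E he') heb]
      · rw [hgsub _ (hg e' he').1.1 (hg e' he').1.2.1 e he hbq]
    · obtain ⟨-, e', he', hbe⟩ := hB₁ b hb
      rw [hq₁ e he, hq₁' b e' he' hbe] at heq
      obtain rfl := hinj e' he' e he heq
      rcases hbe with rfl | rfl
      · exact Finset.subset_insert _ _
      · exact (hg e' he').2
    · obtain ⟨-, e, he, hbe⟩ := hB₁ b hb
      exact Or.inr ⟨e, he, by rw [hq₁ e he, hq₁' b e he hbe]⟩
    · rw [hq₁ e he, hq₁ e' he'] at heq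
      exact hinj e he e' he' heq
  have hm' := hm.union hq₂ Finset.disjoint_sdiff
    (by
      rw [Finset.disjoint_left]
      intro x hx hx'
      rcases Finset.mem_union.1 hx with hx | hx <;> rcases Finset.mem_union.1 hx' with hx' | hx'
      · exact (Finset.mem_sdiff.1 hx').2 hx
      · exact hEB x ((hB₂ x).1 hx').1 (hE₁E hx)
      · exact hEB x (hB₁ x hx).1 (Finset.sdiff_subset hx')
      · obtain ⟨-, htx, hxg⟩ := (hB₂ x).1 hx'
        obtain ⟨-, e, he, rfl | rfl⟩ := hB₁ x hx
        · exact htx (Finset.mem_insert_self _ _)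
        · exact hxg e he rfl)
    (by
      intro e he b hb heb hbq
      obtain ⟨hbB, htb, hbg⟩ := (hB₂ b).1 hb
      rw [if_neg (ht e (hE₁E he)), if_pos (hE₁E he)] at hbq
      exact hbg e he (hgsub b hbB htb e he hbq))
    (by
      intro e he b hb heb _
      obtain ⟨heE, heE₁⟩ := Finset.mem_sdiff.1 he
      obtain ⟨-, e', he', rfl | rfl⟩ := hB₁ b hb
      · exact heE₁ (hsub e heE e' (hE₁E he') heb ▸ he')
      · exact heE₁ (hlink e heE e' he' heb))
  have hB : E₁.image (insert t) ∪ E₁.image g ∪ B₂ = B := by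
    ext b
    constructor
    · intro hb
      rcases Finset.mem_union.1 hb with hb | hb
      · exact (hB₁ b hb).1
      · exact ((hB₂ b).1 hb).1
    · intro hb
      by_cases htb : t ∈ b
      · obtain ⟨e, he, rfl⟩ := hcover b hb htb
        exact Finset.mem_union_left _ (Finset.mem_union_left _ (Finset.mem_image_of_mem _ he))
      by_cases hbg : ∃ e ∈ E₁, b = g e
      · obtain ⟨e, he, rfl⟩ := hbg
        exact Finset.mem_union_left _ (Finset.mem_union_right _ (Finset.mem_image_of_mem _ he))
      · push Not at hbg
        exact Finset.mem_union_right _ ((hB₂ b).2 ⟨hb, htb, hbg⟩)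
  rw [hB, Finset.union_sdiff_of_subset hE₁E, Finset.union_sdiff_of_subset hR] at hm'
  exact ⟨_, hm'⟩

end Apex

section Partition

variable {K : Type*} [Field K] {n d : ℕ} {I J : Ideal (MvPolynomial (Fin n) K)}
  {E B C : Finset (Finset (Fin n))} {q : Finset (Fin n) → Finset (Fin n)}

open Classical in
/-- An interval matching of the three lowest degrees of `P_{I \ J}` extends, by trivial
intervals, to an interval partition of `P_{I \ J}`. -/
theorem IsIntervalMatching.exists_isIntervalPartition (hq : IsIntervalMatching E B C q)
    (hP : ∀ T ∈ sqPoset I J, d ≤ T.card) (hE : ∀ T, T ∈ E ↔ T ∈ degSet I J d)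
    (hB : ∀ T, T ∈ B ↔ T ∈ degSet I J (d + 1)) (hC : ∀ T, T ∈ C ↔ T ∈ degSet I J (d + 2)) :
    ∃ F, IsIntervalPartition I J F ∧ ∀ p ∈ F, d + 2 ≤ p.2.card := by
  set top : Finset (Fin n) → Finset (Fin n) := fun u => if u ∈ E ∪ B then q u else u with htop
  have htop_mem : ∀ u ∈ E ∪ B, top u = q u := fun u hu => if_pos hu
  have htop_not : ∀ u ∉ E ∪ B, top u = u := fun u hu => if_neg hu
  have hqC : ∀ u ∈ E ∪ B, q u ∈ C ∧ u ⊆ q u := by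
    intro u hu
    rcases Finset.mem_union.1 hu with hu | hu
    exacts [hq.mem_left u hu, hq.mem_right u hu]
  have hCnot : ∀ u ∈ C, u ∉ E ∪ B := by
    intro u hu hu'
    have h₁ := ((hC u).1 hu).2
    rcases Finset.mem_union.1 hu' with hu' | hu'
    · have h₂ := ((hE u).1 hu').2
      omega
    · have h₂ := ((hB u).1 hu').2
      omega
  have hsub_top : ∀ u, u ⊆ top u := by
    intro u
    by_cases hu : u ∈ E ∪ B
    · rw [htop_mem u hu]
      exact (hqC u hu).2
    · rw [htop_not u hu]
  have htop_eq : ∀ u ∈ sqPoset I J, ∀ T ∈ sqPoset I J, u ⊆ T → T ⊆ top u → top T = top u := by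
    intro u hu T hT huT hTu
    by_cases huEB : u ∈ E ∪ B
    · rw [htop_mem u huEB] at hTu ⊢
      have hquC := (hqC u huEB).1
      have hcard := ((hC _).1 hquC).2
      by_cases hTeq : T.card = d + 2
      · rw [Finset.eq_of_subset_of_card_le hTu (by omega), htop_not _ (hCnot _ hquC)]
      have hTle := Finset.card_le_card hTu
      have huT' := Finset.card_le_card huT
      have hud := hP u hu
      by_cases hne : u = T
      · rw [← hne, htop_mem u huEB]
      have hlt := Finset.card_lt_card (huT.ssubset_of_ne hne)
      have hTB : T ∈ B := (hB T).2 ⟨hT, by omega⟩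
      have huE : u ∈ E := (hE u).2 ⟨hu, by omega⟩
      rw [htop_mem T (Finset.mem_union_right _ hTB)]
      exact hq.between u huE T hTB huT hTu
    · rw [htop_not u huEB] at hTu
      rw [huT.antisymm hTu]
  set bot : Finset (Fin n) → Prop := fun u => u ∈ sqPoset I J ∧
    (u ∈ B → ∀ e ∈ E, q e ≠ q u) ∧ (u ∉ E ∪ B → ∀ x ∈ E ∪ B, q x ≠ u) with hbot
  have hinj : ∀ u u', bot u → bot u' → top u = top u' → u = u' := by
    intro u u' hu hu' heq
    by_cases huEB : u ∈ E ∪ B <;> by_cases huEB' : u' ∈ E ∪ B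
    · rw [htop_mem u huEB, htop_mem u' huEB'] at heq
      rcases Finset.mem_union.1 huEB with h | h <;> rcases Finset.mem_union.1 huEB' with h' | h'
      · exact hq.inj u h u' h' heq
      · exact absurd heq (hu'.2.1 h' u h)
      · exact absurd heq.symm (hu.2.1 h u' h')
      · rcases hq.eq_or_exists u h u' h' heq with h₀ | ⟨e, he, h₀⟩
        · exact h₀
        · exact absurd h₀ (hu.2.1 h e he)
    · rw [htop_mem u huEB, htop_not u' huEB'] at heq
      exact absurd heq (hu'.2.2 huEB' u huEB)
    · rw [htop_not u huEB, htop_mem u' huEB'] at heq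
      exact absurd heq.symm (hu.2.2 huEB u' huEB')
    · rwa [htop_not u huEB, htop_not u' huEB'] at heq
  have hbotE : ∀ e ∈ E, bot e := by
    intro e he
    refine ⟨((hE e).1 he).1, fun heB => ?_, fun h => absurd (Finset.mem_union_left _ he) h⟩
    have h₁ := ((hE e).1 he).2
    have h₂ := ((hB e).1 heB).2
    omega
  have hbotB : ∀ b ∈ B, (∀ e ∈ E, q e ≠ q b) → bot b := fun b hb h =>
    ⟨((hB b).1 hb).1, fun _ => h, fun h' => absurd (Finset.mem_union_right _ hb) h'⟩
  have hex : ∀ T ∈ sqPoset I J, ∃ u, bot u ∧ u ⊆ T ∧ T ⊆ top u := by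
    intro T hT
    have hright : ∀ b ∈ B, ∃ u, bot u ∧ u ⊆ b ∧ q b = top u := by
      intro b hb
      by_cases h : ∃ e ∈ E, q e = q b
      · obtain ⟨e, he, heq⟩ := h
        refine ⟨e, hbotE e he, hq.subset_of_eq e he b hb heq.symm, ?_⟩
        rw [htop_mem e (Finset.mem_union_left _ he), heq]
      · push Not at h
        exact ⟨b, hbotB b hb h, subset_rfl, (htop_mem b (Finset.mem_union_right _ hb)).symm⟩
    by_cases hTE : T ∈ E
    · exact ⟨T, hbotE T hTE, subset_rfl, hsub_top T⟩
    by_cases hTB : T ∈ B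
    · obtain ⟨u, hu, huT, heq⟩ := hright T hTB
      exact ⟨u, hu, huT, heq ▸ (hq.mem_right T hTB).2⟩
    by_cases h : ∃ x ∈ E ∪ B, q x = T
    · obtain ⟨x, hx, rfl⟩ := h
      rcases Finset.mem_union.1 hx with hx | hx
      · exact ⟨x, hbotE x hx, (hq.mem_left x hx).2,
          (htop_mem x (Finset.mem_union_left _ hx)).symm ▸ subset_rfl⟩
      · obtain ⟨u, hu, huT, heq⟩ := hright x hx
        exact ⟨u, hu, huT.trans (hq.mem_right x hx).2, heq ▸ subset_rfl⟩
    · push Not at h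
      exact ⟨T, ⟨hT, fun h' => absurd h' hTB, fun _ => h⟩, subset_rfl, hsub_top T⟩
  refine ⟨(Finset.univ.filter bot).image fun u => (u, top u), ⟨?_, ?_⟩, ?_⟩
  · intro p hp
    obtain ⟨u, hu, rfl⟩ := Finset.mem_image.1 hp
    have hu' := (Finset.mem_filter.1 hu).2
    refine ⟨hu'.1, ?_, hsub_top u⟩
    change top u ∈ _
    by_cases huEB : u ∈ E ∪ B
    · rw [htop_mem u huEB]
      exact ((hC _).1 (hqC u huEB).1).1
    · rw [htop_not u huEB]
      exact hu'.1
  · intro T hT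
    obtain ⟨u, hu, huT, hTu⟩ := hex T hT
    refine ⟨(u, top u), ⟨Finset.mem_image_of_mem _ (by simpa using hu), huT, hTu⟩, ?_⟩
    rintro p ⟨hp, hpT, hTp⟩
    obtain ⟨u', hu', rfl⟩ := Finset.mem_image.1 hp
    replace hu' := (Finset.mem_filter.1 hu').2
    have heq : u' = u := hinj u' u hu' hu
      ((htop_eq u' hu'.1 T hT hpT hTp).symm.trans (htop_eq u hu.1 T hT huT hTu))
    rw [heq]
  · intro p hp
    obtain ⟨u, hu, rfl⟩ := Finset.mem_image.1 hp
    replace hu := (Finset.mem_filter.1 hu).2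
    change d + 2 ≤ (top u).card
    by_cases huEB : u ∈ E ∪ B
    · rw [htop_mem u huEB, ((hC _).1 (hqC u huEB).1).2]
    · rw [htop_not u huEB]
      have h₀ := hP u hu.1
      have h₁ : u.card ≠ d := fun h =>
        huEB (Finset.mem_union_left _ ((hE u).2 ⟨hu.1, h⟩))
      have h₂ : u.card ≠ d + 1 := fun h =>
        huEB (Finset.mem_union_right _ ((hB u).2 ⟨hu.1, h⟩))
      omega

theorem bddAbove_intervalPartition (hne : (sqPoset I J).Nonempty) :
    BddAbove {k | ∃ F, IsIntervalPartition I J F ∧ ∀ p ∈ F, k ≤ p.2.card} := by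
  refine ⟨n, ?_⟩
  rintro k ⟨F, hF, hk⟩
  obtain ⟨T, hT⟩ := hne
  obtain ⟨p, ⟨hp, -⟩, -⟩ := hF.2 T hT
  exact (hk p hp).trans (card_finset_fin_le p.2)

end Partition

/-- `I` minimally generated by four squarefree monomials of degree `d`,
some `c ∈ C` has support not inside the union of supports of the generators, and
`sdepth I/J = d+1` implies `depth I/J ≤ d+1`. -/
theorem statement1 {K : Type*} [Field K] {n : ℕ} (d : ℕ) (hd : 0 < d)
    (I J : Ideal (MvPolynomial (Fin n) K)) (hJI : J < I)
    (f : Fin 4 → Finset (Fin n)) (hfinj : Function.Injective f)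
    (hfd : ∀ i, (f i).card = d)
    (hI : I = Ideal.span (sqm K '' Set.range f))
    (hmin : ∀ g ∈ Set.range f,
      sqm K g ∉ Ideal.span (sqm K '' (Set.range f \ {g})))
    (hJ : SqfreeGenFrom J (d + 1))
    (hc : ∃ c ∈ degSet I J (d + 2), ¬ c ⊆ f 0 ∪ f 1 ∪ f 2 ∪ f 3)
    (hsd : sdepth I J = d + 1) :
    depthIJ I J ≤ d + 1 := by
  classical
  refine csSup_le' ?_
  rintro k ⟨rs, rfl, hrs, hreg⟩
  by_contra! hlen
  obtain ⟨H, hH, rfl⟩ := hJ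
  subst hI
  have hdn : d < n := by
    by_contra! hnd
    have huniv : ∀ i, f i = Finset.univ := fun i =>
      Finset.eq_univ_of_card _ (le_antisymm (Finset.card_le_univ _) (by simpa [hfd i] using hnd))
    exact absurd (hfinj ((huniv 0).trans (huniv 1).symm)) (by decide)
  have hG : ∀ g ∈ Set.range f, g.card = d := by
    rintro g ⟨i, rfl⟩
    exact hfd i
  have hacyc := isAcyclicTriple_of_isWeaklyRegular hdn hG hH hlen hrs hreg.toIsWeaklyRegular
  have hmem : ∀ T, T ∈ sqPoset (Ideal.span (sqm K '' Set.range f)) (Ideal.span (sqm K '' H)) ↔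
      (∃ g ∈ Set.range f, g ⊆ T) ∧ ∀ g ∈ H, ¬ g ⊆ T := by
    intro T
    rw [sqPoset, Set.mem_ofPred_eq, sqm_mem_span_iff, sqm_mem_span_iff]
    push Not
    rfl
  obtain ⟨c, ⟨hcP, hcd⟩, hcf⟩ := hc
  obtain ⟨t, htc, htf⟩ := Finset.not_subset.1 hcf
  obtain ⟨⟨e₀, he₀, hec⟩, hcH⟩ := (hmem c).1 hcP
  have ht : ∀ i, t ∉ f i := by
    simp only [Finset.mem_union, not_or] at htf
    intro i
    fin_cases i
    exacts [htf.1.1.1, htf.1.1.2, htf.1.2, htf.2]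
  obtain ⟨q, hq⟩ := hacyc.exists_matching_of_apex
    (by
      simp only [Finset.mem_filter, Finset.mem_univ, true_and]
      exact fun b hb => hb.2.1)
    ((Finset.card_le_card (t := Finset.univ.image f) fun T hT => by simpa using hT).trans
      Finset.card_image_le)
    (t := t)
    (by
      simp only [Finset.mem_filter, Finset.mem_univ, true_and]
      rintro _ ⟨i, rfl⟩
      exact ht i)
    (c := c) (by simpa only [Finset.mem_filter, Finset.mem_univ, true_and] using
      ⟨hcd, ⟨e₀, he₀, hec⟩, hcH⟩) htc
    (e₀ := e₀) (by simpa using he₀) hec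
  have hE : ∀ e ∈ Set.range f,
      e ∈ sqPoset (Ideal.span (sqm K '' Set.range f)) (Ideal.span (sqm K '' H)) := by
    intro e he
    refine (hmem e).2 ⟨⟨e, he, subset_rfl⟩, fun g hg hge => ?_⟩
    have h₁ := hH g hg
    have h₂ := Finset.card_le_card hge
    have h₃ := hG e he
    omega
  obtain ⟨F, hF, hFd⟩ := hq.exists_isIntervalPartition (d := d)
    (I := Ideal.span (sqm K '' Set.range f)) (J := Ideal.span (sqm K '' H))
    (by
      intro T hT
      obtain ⟨g, hg, hgT⟩ := ((hmem T).1 hT).1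
      exact hG g hg ▸ Finset.card_le_card hgT)
    (by
      intro T
      simp only [Finset.mem_filter, Finset.mem_univ, true_and, degSet, Set.mem_ofPred_eq]
      refine ⟨fun hT => ⟨hE T hT, hG T hT⟩, fun hT => ?_⟩
      obtain ⟨g, hg, hgT⟩ := ((hmem T).1 hT.1).1
      rwa [← Finset.eq_of_subset_of_card_le hgT (by rw [hG g hg, hT.2])])
    (by simp [degSet, hmem, and_comm])
    (by simp [degSet, hmem, and_comm])
  have hle := le_csSup (bddAbove_intervalPartition ⟨f 0, hE _ ⟨0, rfl⟩⟩) ⟨F, hF, hFd⟩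
  have hle' : d + 2 ≤ d + 1 := hsd ▸ hle
  omega
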